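/- arXiv:2108.04411 — 4 statements merged into one kernel-verified Lean document; each statement's English description precedes it below -/
import Mathlib

section
/- There exists an absolute constant C > 0 such that for every finite-index subgroup Λ of ℤ² and all positive real numbers R1, R2, the number of vectors (x1, x2) ∈ Λ with gcd(x1, x2) = 1, |x1| ≤ R1 and |x2| ≤ R2 is at most C · (R1·R2 / det(Λ) + 1), where det(Λ) denotes the index [ℤ² : Λ]. -/
/-- The index of a subgroup of `ℤ²` containing a primitive vector `p` divides the determinant
of `p` with any other vector of the subgroup. -/
theorem index_dvd_det_of_isCoprime {Λ : AddSubgroup (ℤ × ℤ)} {p q : ℤ × ℤ}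
    (hp : p ∈ Λ) (hq : q ∈ Λ) (hcop : IsCoprime p.1 p.2) :
    (Λ.index : ℤ) ∣ p.1 * q.2 - p.2 * q.1 := by
  obtain ⟨a, b, hab⟩ := hcop
  let φ : ℤ × ℤ →+ ℤ :=
    { toFun := fun v => p.1 * v.2 - p.2 * v.1
      map_zero' := by simp
      map_add' := fun v w => by simp only [Prod.fst_add, Prod.snd_add]; ring }
  have hφ : ∀ v, φ v = p.1 * v.2 - p.2 * v.1 := fun _ => rfl
  have hker : φ.ker ≤ Λ := by
    intro v hv
    rw [AddMonoidHom.mem_ker, hφ] at hv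
    have hv' : v = (a * v.1 + b * v.2) • p := by
      ext
      · simp only [Prod.smul_fst, smul_eq_mul]
        linear_combination (-v.1) * hab - b * hv
      · simp only [Prod.smul_snd, smul_eq_mul]
        linear_combination (-v.2) * hab + a * hv
    rw [hv']
    exact Λ.zsmul_mem hp _
  have hsurj : Function.Surjective φ := fun n =>
    ⟨(-b * n, a * n), by rw [hφ]; linear_combination n * hab⟩
  have hindex : (Λ.map φ).index = Λ.index := by
    rw [AddSubgroup.index_map, sup_eq_left.mpr hker, AddMonoidHom.range_eq_top.mpr hsurj,
      AddSubgroup.index_top, mul_one]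
  have hle : AddSubgroup.zmultiples (φ q) ≤ Λ.map φ :=
    AddSubgroup.zmultiples_le_of_mem (AddSubgroup.mem_map_of_mem φ hq)
  have hdvd := AddSubgroup.index_dvd_of_le hle
  rw [hindex, Int.index_zmultiples] at hdvd
  exact Int.natCast_dvd.mpr hdvd

/-- Two primitive vectors with vanishing determinant whose nonzero first coordinates have the
same sign are equal. -/
theorem eq_of_isCoprime_of_det_eq_zero {a b c d : ℤ} (hab : IsCoprime a b) (hcd : IsCoprime c d)
    (ha : a ≠ 0) (hc : c ≠ 0) (hsign : 0 < a ↔ 0 < c) (hdet : a * d - b * c = 0) :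
    a = c ∧ b = d := by
  have h1 : a ∣ c := hab.dvd_of_dvd_mul_left ⟨d, by linarith⟩
  have h2 : c ∣ a := hcd.dvd_of_dvd_mul_right ⟨b, by linarith⟩
  have h3 : a = c := by
    rcases Int.natAbs_eq_natAbs_iff.mp (Int.natAbs_eq_of_dvd_dvd h1 h2) with h | h <;> omega
  refine ⟨h3, mul_left_cancel₀ ha ?_⟩
  subst h3
  linarith

/-- A set carrying a `[-1, 1]`-valued function that is `δ`-separated on each of two classes
is finite with at most `4 / δ + 4` elements. -/
theorem finite_and_ncard_le_of_separated {ι : Type*} (S : Set ι) (f : ι → ℝ) (s : ι → Prop)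
    {δ : ℝ} (hδ : 0 < δ) (hf : ∀ p ∈ S, |f p| ≤ 1)
    (hsep : ∀ p ∈ S, ∀ q ∈ S, (s p ↔ s q) → |f p - f q| < δ → p = q) :
    S.Finite ∧ (S.ncard : ℝ) ≤ 4 / δ + 4 := by
  classical
  let g : ι → ℤ × Prop := fun p => (⌊f p / δ⌋, s p)
  let T : Finset (ℤ × Prop) := Finset.Icc ⌊-1 / δ⌋ ⌊1 / δ⌋ ×ˢ Finset.univ
  have hmaps : ∀ p ∈ S, g p ∈ (T : Set (ℤ × Prop)) := by
    intro p hp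
    have := abs_le.mp (hf p hp)
    simp only [T, g, Finset.coe_product, Set.mem_prod, Finset.mem_coe, Finset.mem_Icc,
      Finset.mem_univ, and_true]
    constructor <;> apply Int.floor_le_floor <;> gcongr
    · exact this.1
    · exact this.2
  have hinj : Set.InjOn g S := by
    intro p hp q hq hpq
    obtain ⟨h1, h2⟩ := Prod.mk.inj hpq
    refine hsep p hp q hq (iff_of_eq h2) ?_
    have h3 := Int.abs_sub_lt_one_of_floor_eq_floor h1
    rwa [← sub_div, abs_div, abs_of_pos hδ, div_lt_one hδ] at h3
  refine ⟨Set.Finite.of_injOn hmaps hinj T.finite_toSet, ?_⟩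
  have hcard := Set.ncard_le_ncard_of_injOn g hmaps hinj T.finite_toSet
  rw [Set.ncard_coe_finset, Finset.card_product, Finset.card_univ, Fintype.card_prop,
    Int.card_Icc] at hcard
  have hle : ⌊-1 / δ⌋ ≤ ⌊1 / δ⌋ := Int.floor_le_floor (by gcongr; norm_num)
  have hnat : (((⌊1 / δ⌋ + 1 - ⌊-1 / δ⌋).toNat : ℤ) : ℝ) = ⌊1 / δ⌋ + 1 - ⌊-1 / δ⌋ := by
    rw [Int.toNat_of_nonneg (by omega)]
    push_cast
    ring
  have hcard' : (S.ncard : ℝ) ≤ (((⌊1 / δ⌋ + 1 - ⌊-1 / δ⌋).toNat : ℤ) : ℝ) * 2 := by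
    exact_mod_cast hcard
  rw [hnat] at hcard'
  have h1 := Int.floor_le (1 / δ)
  have h2 := Int.lt_floor_add_one (-1 / δ)
  have h3 : -1 / δ = -(1 / δ) := neg_div _ _
  have h4 : 4 / δ = 4 * (1 / δ) := by ring
  linarith

/-- Slopes `b / a`, `d / c` (rescaled to a box with sides `R`, `R'`) closer than `D / (R R')`
come from vectors whose determinant is smaller than `D`. -/
theorem abs_det_lt_of_abs_slope_sub_lt {a b c d R R' D : ℝ} (hR : 0 < R) (hR' : 0 < R')
    (ha : a ≠ 0) (hc : c ≠ 0) (haR : |a| ≤ R) (hcR : |c| ≤ R)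
    (h : |b * R / (a * R') - d * R / (c * R')| < D / (R * R')) :
    |a * d - b * c| < D := by
  have hD : 0 < D := by
    have := (abs_nonneg _).trans_lt h
    exact (div_pos_iff_of_pos_right (mul_pos hR hR')).mp this
  have heq : a * d - b * c =
      -(b * R / (a * R') - d * R / (c * R')) * (a * c * R' / R) := by
    field_simp
    ring
  have hbound : |a * c * R' / R| ≤ R * R' := by
    rw [abs_div, abs_mul, abs_mul, abs_of_pos hR, abs_of_pos hR', div_le_iff₀ hR]
    calc |a| * |c| * R' ≤ R * R * R' := by gcongr
      _ = R * R' * R := by ring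
  rw [heq, abs_mul, abs_neg]
  calc _ ≤ |b * R / (a * R') - d * R / (c * R')| * (R * R') := by gcongr
    _ < D / (R * R') * (R * R') := by gcongr
    _ = D := by field_simp

/-- Counting a family of primitive vectors `(x i, y i)` in the sector `|y| / R' ≤ |x| / R` of a
box, when all determinants are divisible by `D`. -/
theorem finite_and_ncard_le_of_dvd_det {ι : Type*} (S : Set ι) (x y : ι → ℤ) {D : ℕ}
    (hD : D ≠ 0) {R R' : ℝ} (hR : 0 < R) (hR' : 0 < R')
    (hxy : ∀ p ∈ S, ∀ q ∈ S, x p = x q → y p = y q → p = q)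
    (hcop : ∀ p ∈ S, IsCoprime (x p) (y p))
    (hx : ∀ p ∈ S, |(x p : ℝ)| ≤ R)
    (hsector : ∀ p ∈ S, |(y p : ℝ)| * R ≤ |(x p : ℝ)| * R')
    (hdvd : ∀ p ∈ S, ∀ q ∈ S, (D : ℤ) ∣ x p * y q - y p * x q) :
    S.Finite ∧ (S.ncard : ℝ) ≤ 4 * (R * R' / D) + 4 := by
  have hDpos : (0 : ℝ) < D := by positivity
  have hx0 : ∀ p ∈ S, x p ≠ 0 := by
    intro p hp h0
    have h1 := hsector p hp
    rw [h0, Int.cast_zero, abs_zero, zero_mul] at h1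
    have h2 : |(y p : ℝ)| = 0 := le_antisymm (nonpos_of_mul_nonpos_left h1 hR) (abs_nonneg _)
    have h3 : y p = 0 := by exact_mod_cast abs_eq_zero.mp h2
    have h4 := hcop p hp
    rw [h0, h3] at h4
    exact not_isCoprime_zero_zero h4
  have key := finite_and_ncard_le_of_separated S (fun p => (y p : ℝ) * R / (x p * R'))
    (fun p => 0 < x p) (δ := D / (R * R')) (by positivity) ?_ ?_
  · rwa [show 4 / ((D : ℝ) / (R * R')) = 4 * (R * R' / D) by field_simp] at key
  · intro p hp
    rw [abs_div, abs_mul, abs_mul, abs_of_pos hR, abs_of_pos hR']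
    exact div_le_one_of_le₀ (hsector p hp) (by positivity)
  · intro p hp q hq hs hlt
    have hlt' := abs_det_lt_of_abs_slope_sub_lt hR hR' (Int.cast_ne_zero.mpr (hx0 p hp))
      (Int.cast_ne_zero.mpr (hx0 q hq)) (hx p hp) (hx q hq) hlt
    have hdet : x p * y q - y p * x q = 0 :=
      Int.eq_zero_of_abs_lt_dvd (hdvd p hp q hq) (by exact_mod_cast hlt')
    obtain ⟨h1, h2⟩ := eq_of_isCoprime_of_det_eq_zero (hcop p hp) (hcop q hq) (hx0 p hp)
      (hx0 q hq) hs hdet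
    exact hxy p hp q hq h1 h2

/-- Lattice point counting in lopsided boxes: there is an absolute constant `C > 0`
such that for every finite-index subgroup `Λ ≤ ℤ²` (with `det Λ = [ℤ² : Λ]`) and all
`R₁, R₂ > 0`, the number of primitive vectors `(x₁,x₂) ∈ Λ` with `|x₁| ≤ R₁` and
`|x₂| ≤ R₂` is at most `C·(R₁R₂/det Λ + 1)`. -/
theorem primitive_lattice_points_in_box :
    ∃ C : ℝ, 0 < C ∧
      ∀ Λ : AddSubgroup (ℤ × ℤ), Λ.index ≠ 0 →
        ∀ R1 R2 : ℝ, 0 < R1 → 0 < R2 →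
          ((Set.ncard {p : ℤ × ℤ | p ∈ Λ ∧ IsCoprime p.1 p.2 ∧
              (|p.1| : ℝ) ≤ R1 ∧ (|p.2| : ℝ) ≤ R2} : ℝ)) ≤
            C * (R1 * R2 / (Λ.index : ℝ) + 1) := by
  refine ⟨8, by norm_num, fun Λ hΛ R1 R2 h1 h2 => ?_⟩
  set S := {p : ℤ × ℤ | p ∈ Λ ∧ IsCoprime p.1 p.2 ∧ (|p.1| : ℝ) ≤ R1 ∧ (|p.2| : ℝ) ≤ R2}
  let A := {p ∈ S | |(p.2 : ℝ)| * R1 ≤ |(p.1 : ℝ)| * R2}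
  let B := {p ∈ S | |(p.1 : ℝ)| * R2 ≤ |(p.2 : ℝ)| * R1}
  obtain ⟨-, hA⟩ := finite_and_ncard_le_of_dvd_det A Prod.fst Prod.snd hΛ h1 h2
    (fun _ _ _ _ => Prod.ext) (fun p hp => hp.1.2.1) (fun p hp => by simpa using hp.1.2.2.1)
    (fun p hp => hp.2) (fun p hp q hq => index_dvd_det_of_isCoprime hp.1.1 hq.1.1 hp.1.2.1)
  obtain ⟨-, hB⟩ := finite_and_ncard_le_of_dvd_det B Prod.snd Prod.fst hΛ h2 h1
    (fun _ _ _ _ h h' => Prod.ext h' h) (fun p hp => hp.1.2.1.symm)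
    (fun p hp => by simpa using hp.1.2.2.2) (fun p hp => hp.2)
    (fun p hp q hq => by
      have h := index_dvd_det_of_isCoprime hp.1.1 hq.1.1 hp.1.2.1
      rwa [← dvd_neg, neg_sub] at h)
  have hS : S = A ∪ B := by
    rw [← Set.sep_or]
    exact (Set.sep_eq_self_iff_mem_true.mpr fun p _ => le_total _ _).symm
  have hcard : (S.ncard : ℝ) ≤ A.ncard + B.ncard := by
    rw [hS]
    exact_mod_cast Set.ncard_union_le A B
  rw [mul_comm R2 R1] at hB
  linarith
end

section
/- There is an absolute constant C such that for all real X ≥ 2, Σ d(x1·x2·x3)/(x1·x2·x3) ≤ C·(log X)³, where the sum ranges over all triples (x1, x2, x3) of pairwise coprime squarefree positive integers with x1·x2·x3 ≤ X for which the equation x1·y1² + x2·y2² = x3·y3² has a solution in integers (y1, y2, y3) ≠ (0, 0, 0). -/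
open Finset

open MeasureTheory in
/-- A quantitative form of Blichfeldt's theorem. -/
theorem exists_finset_card_gt_forall_vadd_mem {E L : Type*} [MeasurableSpace E] {μ : Measure E}
    {F s : Set E} [AddGroup L] [Countable L] [AddAction L E] [MeasurableSpace L]
    [MeasurableVAdd L E] [VAddInvariantMeasure L E μ] (fund : IsAddFundamentalDomain L F μ)
    (hs : MeasurableSet s) {m : ℕ} (h : m * μ F < μ s) :
    ∃ (x : E) (t : Finset L), m < #t ∧ ∀ g ∈ t, g +ᵥ x ∈ s := by
  classical
  contrapose! h
  have key (x : E) : ∑' g : L, s.indicator (1 : E → ENNReal) (g +ᵥ x) ≤ m := by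
    rw [ENNReal.tsum_eq_iSup_sum]
    refine iSup_le fun t => ?_
    have hle : #(t.filter fun g => g +ᵥ x ∈ s) ≤ m := by
      by_contra! hlt
      obtain ⟨g, hg, hgs⟩ := h x _ hlt
      exact hgs (mem_filter.1 hg).2
    simp only [Set.indicator_apply, Pi.one_apply]
    rw [← Finset.sum_filter, Finset.sum_const, nsmul_eq_mul, mul_one]
    exact_mod_cast hle
  calc μ s = ∫⁻ x, s.indicator 1 x ∂μ := (lintegral_indicator_one hs).symm
    _ = ∑' g : L, ∫⁻ x in F, s.indicator 1 (g +ᵥ x) ∂μ := fund.lintegral_eq_tsum'' _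
    _ = ∫⁻ x in F, ∑' g : L, s.indicator 1 (g +ᵥ x) ∂μ := by
      refine (lintegral_tsum fun g => ?_).symm
      exact ((measurable_one.indicator hs).comp (measurable_const_vadd g)).aemeasurable
    _ ≤ ∫⁻ _ in F, m ∂μ := lintegral_mono fun x => key x
    _ = m * μ F := by simp

open MeasureTheory in
theorem exists_finset_int_card_gt_forall_add_mem {ι : Type*} [Fintype ι] {s : Set (ι → ℝ)}
    (hs : MeasurableSet s) {m : ℕ} (h : m < volume s) :
    ∃ (u : ι → ℝ) (t : Finset (ι → ℤ)), m < #t ∧ ∀ k ∈ t, (fun i => (k i : ℝ) + u i) ∈ s := by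
  classical
  have fund := ZSpan.isAddFundamentalDomain' (Pi.basisFun ℝ ι) (volume : Measure (ι → ℝ))
  have hF : volume (ZSpan.fundamentalDomain (Pi.basisFun ℝ ι)) = 1 := by
    rw [ZSpan.fundamentalDomain_pi_basisFun, Real.volume_pi_Ico]
    simp
  have : Countable (Submodule.span ℤ (Set.range (Pi.basisFun ℝ ι))).toAddSubgroup :=
    inferInstanceAs <| Countable (Submodule.span ℤ (Set.range (Pi.basisFun ℝ ι)))
  obtain ⟨u, t, hm, ht⟩ := exists_finset_card_gt_forall_vadd_mem fund hs
    (m := m) (by rwa [hF, mul_one])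
  have hcoord (g : (Submodule.span ℤ (Set.range (Pi.basisFun ℝ ι))).toAddSubgroup) :
      ∃ k : ι → ℤ, ∀ i, (k i : ℝ) = (g : ι → ℝ) i := by
    have := ((Pi.basisFun ℝ ι).mem_span_iff_repr_mem ℤ (g : ι → ℝ)).1 g.2
    choose k hk using this
    exact ⟨k, fun i => by simpa using hk i⟩
  choose k hk using hcoord
  have hinj : Function.Injective k := fun a b hab => by
    ext i
    rw [← hk, ← hk, hab]
  refine ⟨u, t.image k, by rwa [card_image_of_injective _ hinj], ?_⟩
  simp only [mem_image, forall_exists_index, and_imp, forall_apply_eq_imp_iff₂]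
  intro g hg
  convert ht g hg using 2
  rename_i i
  rw [hk]
  rfl

open MeasureTheory in
theorem volume_unit_cylinder :
    volume {v : Fin 3 → ℝ | v 0 ^ 2 + v 1 ^ 2 < 1 ∧ v 2 ^ 2 < 1} =
      ENNReal.ofReal (2 * Real.pi) := by
  have h1 := volume_preserving_piFinSuccAbove (fun _ : Fin 3 => ℝ) 2
  have h2 := PiLp.volume_preserving_toLp (Fin 2)
  have hdisc : volume {v : Fin 2 → ℝ | v 0 ^ 2 + v 1 ^ 2 < 1} = ENNReal.ofReal Real.pi := by
    have := h2.measure_preimage (s := Metric.ball 0 1) measurableSet_ball.nullMeasurableSet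
    rw [EuclideanSpace.volume_ball_fin_two, ENNReal.ofReal_one, one_pow, one_mul] at this
    rw [← this]
    congr 1
    ext v
    simp only [Set.mem_ofPred_eq, Set.mem_preimage, mem_ball_zero_iff]
    rw [← sq_lt_one_iff₀ (norm_nonneg _), EuclideanSpace.real_norm_sq_eq]
    simp
  have hset : {v : Fin 3 → ℝ | v 0 ^ 2 + v 1 ^ 2 < 1 ∧ v 2 ^ 2 < 1} =
      MeasurableEquiv.piFinSuccAbove (fun _ : Fin 3 => ℝ) 2 ⁻¹'
        (Metric.ball 0 1 ×ˢ {v : Fin 2 → ℝ | v 0 ^ 2 + v 1 ^ 2 < 1}) := by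
    ext v
    change _ ↔ v 2 ∈ Metric.ball 0 1 ∧ v 0 ^ 2 + v 1 ^ 2 < 1
    simp [and_comm]
  have hm : MeasurableSet {v : Fin 2 → ℝ | v 0 ^ 2 + v 1 ^ 2 < 1} :=
    measurableSet_lt (by fun_prop) (by fun_prop)
  rw [hset, h1.measure_preimage (measurableSet_ball.prod hm).nullMeasurableSet,
    Measure.volume_eq_prod, Measure.prod_prod, hdisc, Real.volume_ball, mul_one,
    ENNReal.ofReal_mul zero_le_two]

open MeasureTheory in
theorem volume_elliptic_cylinder {a b c r : ℝ} (ha : 0 < a) (hb : 0 < b) (hc : 0 < c)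
    (hr : 0 < r) :
    volume {v : Fin 3 → ℝ | a * v 0 ^ 2 + b * v 1 ^ 2 < r ∧ c * v 2 ^ 2 < r} =
      ENNReal.ofReal (2 * Real.pi * (r * √r / √(a * b * c))) := by
  let d : Fin 3 → ℝ := ![√(a / r), √(b / r), √(c / r)]
  have hdet : (Matrix.toLin' (Matrix.diagonal d)).det = √(a * b * c) / (r * √r) := by
    rw [LinearMap.det_toLin', Matrix.det_diagonal]
    simp only [Fin.prod_univ_three, d, Matrix.cons_val]
    rw [Real.sqrt_div ha.le, Real.sqrt_div hb.le, Real.sqrt_div hc.le,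
      Real.sqrt_mul (by positivity), Real.sqrt_mul ha.le]
    have : r = √r * √r := (Real.mul_self_sqrt hr.le).symm
    field_simp
    rw [Real.sq_sqrt hr.le]
  have h0 : (Matrix.toLin' (Matrix.diagonal d)).det ≠ 0 := by rw [hdet]; positivity
  have := Measure.addHaar_preimage_linearMap (μ := volume) h0
    {v : Fin 3 → ℝ | v 0 ^ 2 + v 1 ^ 2 < 1 ∧ v 2 ^ 2 < 1}
  rw [volume_unit_cylinder, hdet, inv_div, abs_of_pos (by positivity),
    ← ENNReal.ofReal_mul (by positivity)] at this
  rw [mul_comm (2 * Real.pi), ← this]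
  congr 1
  ext v
  simp only [Set.mem_preimage, Set.mem_ofPred_eq, Matrix.toLin'_apply, Matrix.mulVec_diagonal, d,
    Matrix.cons_val, mul_pow]
  rw [Real.sq_sqrt (by positivity), Real.sq_sqrt (by positivity), Real.sq_sqrt (by positivity)]
  have e1 : a / r * v 0 ^ 2 + b / r * v 1 ^ 2 = (a * v 0 ^ 2 + b * v 1 ^ 2) / r := by ring
  have e2 : c / r * v 2 ^ 2 = (c * v 2 ^ 2) / r := by ring
  rw [e1, e2, div_lt_one hr, div_lt_one hr]

/-- The bilinear form attached to the diagonal form `p x² + q y² - r z²`. -/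
def ternaryBilin (p q r : ℤ) (v w : Fin 3 → ℤ) : ℤ :=
  p * v 0 * w 0 + q * v 1 * w 1 - r * v 2 * w 2

theorem dvd_ternaryBilin_of_dvd {p q r : ℤ} (hpq : IsCoprime p q) (hpr : IsCoprime p r)
    (hqr : IsCoprime q r) {w : Fin 3 → ℤ} (hw : p * q * r ∣ ternaryBilin p q r w w)
    (hwp : IsCoprime p (w 1)) (hwq : IsCoprime q (w 0)) (hwr : IsCoprime r (w 0))
    {u v : Fin 3 → ℤ} (hu : p * q * r ∣ ternaryBilin p q r u w)
    (hv : p * q * r ∣ ternaryBilin p q r v w) : p * q * r ∣ ternaryBilin p q r u v := by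
  obtain ⟨a, ha⟩ := hw
  obtain ⟨b, hb⟩ := hu
  obtain ⟨c, hc⟩ := hv
  simp only [ternaryBilin] at *
  have hp : p ∣ p * u 0 * v 0 + q * u 1 * v 1 - r * u 2 * v 2 := by
    have : IsCoprime p (q * w 1 * w 1) := (hpq.mul_right hwp).mul_right hwp
    refine this.dvd_of_dvd_mul_left
      (Dvd.intro (q * w 1 * w 1 * u 0 * v 0 + (q * r * b - u 0 * w 0) * (q * w 1 * v 1)
        + r * w 2 * u 2 * (q * r * c - v 0 * w 0)
        - r * u 2 * v 2 * (q * r * a - w 0 * w 0)) ?_)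
    linear_combination -(q * w 1 * v 1) * hb - r * w 2 * u 2 * hc + r * u 2 * v 2 * ha
  have hq : q ∣ p * u 0 * v 0 + q * u 1 * v 1 - r * u 2 * v 2 := by
    have : IsCoprime q (p * w 0 * w 0) := (hpq.symm.mul_right hwq).mul_right hwq
    refine this.dvd_of_dvd_mul_left
      (Dvd.intro (p * w 0 * w 0 * u 1 * v 1 + (p * r * b - u 1 * w 1) * (p * w 0 * v 0)
        + r * w 2 * u 2 * (p * r * c - v 1 * w 1)
        - r * u 2 * v 2 * (p * r * a - w 1 * w 1)) ?_)
    linear_combination -(p * w 0 * v 0) * hb - r * w 2 * u 2 * hc + r * u 2 * v 2 * ha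
  have hr : r ∣ p * u 0 * v 0 + q * u 1 * v 1 - r * u 2 * v 2 := by
    have : IsCoprime r (p * w 0 * w 0) := (hpr.symm.mul_right hwr).mul_right hwr
    refine this.dvd_of_dvd_mul_left
      (Dvd.intro (-p * w 0 * w 0 * u 2 * v 2 + (p * q * b + u 2 * w 2) * (p * w 0 * v 0)
        - q * w 1 * u 1 * (p * q * c + v 2 * w 2)
        + q * u 1 * v 1 * (p * q * a + w 2 * w 2)) ?_)
    linear_combination -(p * w 0 * v 0) * hb + q * w 1 * u 1 * hc - q * u 1 * v 1 * ha
  exact (hpr.mul_left hqr).mul_dvd (hpq.mul_dvd hp hq) hr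

/-- Every isotropic class of the form `p x² + q y² - r z²` modulo `p q r` contains a small
nontrivial zero of the form. -/
theorem exists_small_zero {p q r : ℤ} (hp : 0 < p) (hq : 0 < q) (hr : 0 < r)
    (hpq : IsCoprime p q) (hpr : IsCoprime p r)
    (hqr : IsCoprime q r) {w : Fin 3 → ℤ} (hw : p * q * r ∣ ternaryBilin p q r w w)
    (hwp : IsCoprime p (w 1)) (hwq : IsCoprime q (w 0)) (hwr : IsCoprime r (w 0)) :
    ∃ v : Fin 3 → ℤ, v ≠ 0 ∧ ternaryBilin p q r v v = 0 ∧
      p * q * r ∣ ternaryBilin p q r v w ∧ r * v 2 ^ 2 < 2 * (p * q * r) := by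
  obtain ⟨n, hn⟩ : ∃ n : ℕ, p * q * r = n := Int.eq_ofNat_of_zero_le (by positivity)
  have hn0 : 0 < n := by zify; rw [← hn]; positivity
  have hnR : (p : ℝ) * q * r = n := by exact_mod_cast hn
  have hp' : (0 : ℝ) < p := by exact_mod_cast hp
  have hq' : (0 : ℝ) < q := by exact_mod_cast hq
  have hr' : (0 : ℝ) < r := by exact_mod_cast hr
  have hn' : (0 : ℝ) < n := by exact_mod_cast hn0
  have hvol : ((n * 2 : ℕ) : ENNReal) < MeasureTheory.volume
      {v : Fin 3 → ℝ | (p : ℝ) * v 0 ^ 2 + q * v 1 ^ 2 < n / 2 ∧ r * v 2 ^ 2 < n / 2} := by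
    rw [volume_elliptic_cylinder hp' hq' hr' (by positivity), hnR, ← ENNReal.ofReal_natCast,
      ENNReal.ofReal_lt_ofReal_iff (by positivity), Real.sqrt_div hn'.le]
    have h2 : 0 < √(2 : ℝ) := by positivity
    have h3 : √(2 : ℝ) < 3 / 2 := by
      rw [Real.sqrt_lt' (by norm_num)]; norm_num
    have h4 : 0 < √(n : ℝ) := by positivity
    have : 2 * Real.pi * (↑n / 2 * (√↑n / √2) / √↑n) = n * (Real.pi / √2) := by
      field_simp
    rw [this]
    push_cast
    gcongr
    rw [lt_div_iff₀ h2]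
    linarith [Real.pi_gt_three]
  have hmeas : MeasurableSet
      {v : Fin 3 → ℝ | (p : ℝ) * v 0 ^ 2 + q * v 1 ^ 2 < n / 2 ∧ r * v 2 ^ 2 < n / 2} := by
    rw [Set.ofPred_and]
    exact (measurableSet_lt (by fun_prop) (by fun_prop)).inter
      (measurableSet_lt (by fun_prop) (by fun_prop))
  obtain ⟨u, t, ht, hut⟩ := exists_finset_int_card_gt_forall_add_mem hmeas hvol
  obtain ⟨y, -, hy⟩ := exists_lt_card_fiber_of_mul_lt_card_of_maps_to
    (f := fun k => ternaryBilin p q r k w % n) (t := Finset.Ico (0 : ℤ) n) (s := t) (n := 2)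
    (fun k _ => Finset.mem_Ico.2 ⟨Int.emod_nonneg _ (by omega), Int.emod_lt_of_pos _ (by omega)⟩)
    (by simpa using ht)
  obtain ⟨a, b, c, ha, hb, hc, hab, hac, hbc⟩ := two_lt_card_iff.1 hy
  rw [mem_filter] at ha hb hc
  have hdvd {k l : Fin 3 → ℤ} (hk : ternaryBilin p q r k w % n = y)
      (hl : ternaryBilin p q r l w % n = y) : p * q * r ∣ ternaryBilin p q r (k - l) w := by
    have : ternaryBilin p q r (k - l) w = ternaryBilin p q r k w - ternaryBilin p q r l w := by
      simp only [ternaryBilin, Pi.sub_apply]; ring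
    rw [this, hn]
    exact Int.ModEq.dvd (hl.trans hk.symm)
  have hself {k : Fin 3 → ℤ} (hk : p * q * r ∣ ternaryBilin p q r k w) :
      p * q * r ∣ ternaryBilin p q r k k :=
    dvd_ternaryBilin_of_dvd hpq hpr hqr hw hwp hwq hwr hk hk
  have finish {k l : Fin 3 → ℤ} (hk : k ∈ t) (hl : l ∈ t) (hkl : k ≠ l)
      (hd : p * q * r ∣ ternaryBilin p q r (k - l) w)
      (h2 : p * q * r * 2 ∣ ternaryBilin p q r (k - l) (k - l)) :
      ∃ v : Fin 3 → ℤ, v ≠ 0 ∧ ternaryBilin p q r v v = 0 ∧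
        p * q * r ∣ ternaryBilin p q r v w ∧ r * v 2 ^ 2 < 2 * (p * q * r) := by
    obtain ⟨hk1, hk2⟩ := hut k hk
    obtain ⟨hl1, hl2⟩ := hut l hl
    have b1 : p * (k - l) 0 ^ 2 + q * (k - l) 1 ^ 2 < 2 * (p * q * r) := by
      rw [hn]
      have : (p : ℝ) * (k 0 - l 0) ^ 2 + q * (k 1 - l 1) ^ 2 < 2 * n := by
        have e0 := mul_nonneg hp'.le (sq_nonneg ((k 0 + u 0) + (l 0 + u 0) : ℝ))
        have e1 := mul_nonneg hq'.le (sq_nonneg ((k 1 + u 1) + (l 1 + u 1) : ℝ))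
        linarith
      exact_mod_cast this
    have b2 : r * (k - l) 2 ^ 2 < 2 * (p * q * r) := by
      rw [hn]
      have : (r : ℝ) * (k 2 - l 2) ^ 2 < 2 * n := by
        have e0 := mul_nonneg hr'.le (sq_nonneg ((k 2 + u 2) + (l 2 + u 2) : ℝ))
        linarith
      exact_mod_cast this
    refine ⟨k - l, sub_ne_zero.2 hkl, Int.eq_zero_of_abs_lt_dvd h2 ?_, hd, b2⟩
    have c0 : 0 ≤ p * (k - l) 0 ^ 2 := by positivity
    have c1 : 0 ≤ q * (k - l) 1 ^ 2 := by positivity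
    have c2 : 0 ≤ r * (k - l) 2 ^ 2 := by positivity
    have : ternaryBilin p q r (k - l) (k - l) =
      p * (k - l) 0 ^ 2 + q * (k - l) 1 ^ 2 - r * (k - l) 2 ^ 2 := by
      simp only [ternaryBilin]; ring
    rw [this, abs_lt]
    constructor <;> linarith
  have dab := hdvd ha.2 hb.2
  have dbc := hdvd hb.2 hc.2
  have dac := hdvd ha.2 hc.2
  obtain ⟨f, hf⟩ := hself dab
  obtain ⟨g, hg⟩ := hself dbc
  obtain ⟨e, he⟩ := dvd_ternaryBilin_of_dvd hpq hpr hqr hw hwp hwq hwr dab dbc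
  have hsum : ternaryBilin p q r (a - c) (a - c) = p * q * r * (f + g + 2 * e) := by
    rw [mul_add, mul_add, ← hf, ← hg, mul_left_comm, ← he]
    simp only [ternaryBilin, Pi.sub_apply]
    ring
  rcases Int.even_or_odd' f with ⟨f', hf' | hf'⟩
  · exact finish ha.1 hb.1 hab dab (hf ▸ mul_dvd_mul_left _ ⟨f', hf'⟩)
  rcases Int.even_or_odd' g with ⟨g', hg' | hg'⟩
  · exact finish hb.1 hc.1 hbc dbc (hg ▸ mul_dvd_mul_left _ ⟨g', hg'⟩)
  · exact finish ha.1 hc.1 hac dac (hsum ▸ mul_dvd_mul_left _ ⟨f' + g' + 1 + e, by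
      rw [hf', hg']; ring⟩)

theorem Squarefree.prime_dvd_of_sq_dvd_mul_sq {r c l : ℤ} (hr : Squarefree r) (hl : Prime l)
    (h : l ^ 2 ∣ r * c ^ 2) : l ∣ c := by
  by_contra hc
  have : IsCoprime (l ^ 2) (c ^ 2) := ((hl.irreducible.coprime_iff_not_dvd).2 hc).pow
  have h2 := this.dvd_of_dvd_mul_right h
  rw [sq] at h2
  exact hl.not_isUnit (hr l h2)

/-- A nontrivial zero of a diagonal ternary form with squarefree coefficients is a multiple of a
zero with pairwise coprime coordinates. -/
theorem exists_eq_smul_pairwise_coprime {p q r : ℤ} (hp : Squarefree p) (hq : Squarefree q)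
    (hr : Squarefree r) {v : Fin 3 → ℤ} (hv : v ≠ 0) (hv0 : ternaryBilin p q r v v = 0) :
    ∃ (h : ℕ) (u : Fin 3 → ℤ), h ≠ 0 ∧ v = (h : ℤ) • u ∧ ternaryBilin p q r u u = 0 ∧
      IsCoprime (u 0) (u 1) ∧ IsCoprime (u 0) (u 2) ∧ IsCoprime (u 1) (u 2) := by
  obtain ⟨i, hi⟩ := Function.ne_iff.1 hv
  obtain ⟨u, hu, hu1⟩ := Finset.extract_gcd v (s := univ) univ_nonempty
  have h0 : univ.gcd v ≠ 0 := fun h0 => hi (Finset.gcd_eq_zero_iff.1 h0 i (mem_univ i))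
  have hnn : 0 ≤ univ.gcd v := Int.nonneg_of_normalize_eq_self Finset.normalize_gcd
  generalize univ.gcd v = h at hu h0 hnn
  lift h to ℕ using hnn
  have hvu (i : Fin 3) : v i = h * u i := hu i (mem_univ i)
  have hz : ternaryBilin p q r u u = 0 := by
    have : (h : ℤ) ^ 2 * ternaryBilin p q r u u = 0 := by
      rw [← hv0]
      simp only [ternaryBilin, hvu]
      ring
    exact (mul_eq_zero.1 this).resolve_left (pow_ne_zero _ h0)
  have hno {l : ℤ} (hl : Prime l) (h0 : l ∣ u 0) (h1 : l ∣ u 1) (h2 : l ∣ u 2) : False := by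
    have : l ∣ univ.gcd u := Finset.dvd_gcd fun i _ => by fin_cases i <;> assumption
    rw [hu1] at this
    exact hl.not_isUnit (isUnit_of_dvd_one this)
  have hz' : p * u 0 ^ 2 + q * u 1 ^ 2 = r * u 2 ^ 2 := by
    simp only [ternaryBilin] at hz
    linear_combination hz
  refine ⟨h, u, by exact_mod_cast h0, funext hvu, hz, ?_, ?_, ?_⟩
  all_goals
    refine isCoprime_of_prime_dvd (fun hc => ?_) fun l hl ha hb => ?_
  · rw [hc.1, hc.2] at hz'
    have : r * u 2 ^ 2 = 0 := by linarith
    rcases mul_eq_zero.1 this with h | h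
    · exact hr.ne_zero h
    · exact hno Int.prime_two (by simp [hc.1]) (by simp [hc.2])
        (by simp [(pow_eq_zero_iff two_ne_zero).1 h])
  · refine hno hl ha hb (hr.prime_dvd_of_sq_dvd_mul_sq hl ?_)
    rw [← hz']
    exact dvd_add ((pow_dvd_pow_of_dvd ha 2).mul_left _) ((pow_dvd_pow_of_dvd hb 2).mul_left _)
  · rw [hc.1, hc.2] at hz'
    have : q * u 1 ^ 2 = 0 := by linarith
    rcases mul_eq_zero.1 this with h | h
    · exact hq.ne_zero h
    · exact hno Int.prime_two (by simp [hc.1])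
        (by simp [(pow_eq_zero_iff two_ne_zero).1 h]) (by simp [hc.2])
  · refine hno hl ha (hq.prime_dvd_of_sq_dvd_mul_sq hl ?_) hb
    rw [eq_sub_of_add_eq' hz']
    exact dvd_sub ((pow_dvd_pow_of_dvd hb 2).mul_left _) ((pow_dvd_pow_of_dvd ha 2).mul_left _)
  · rw [hc.1, hc.2] at hz'
    have : p * u 0 ^ 2 = 0 := by linarith
    rcases mul_eq_zero.1 this with h | h
    · exact hp.ne_zero h
    · exact hno Int.prime_two (by simp [(pow_eq_zero_iff two_ne_zero).1 h])
        (by simp [hc.1]) (by simp [hc.2])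
  · refine hno hl (hp.prime_dvd_of_sq_dvd_mul_sq hl ?_) ha hb
    rw [eq_sub_of_add_eq hz']
    exact dvd_sub ((pow_dvd_pow_of_dvd hb 2).mul_left _) ((pow_dvd_pow_of_dvd ha 2).mul_left _)

theorem isCoprime_of_mul_sq_add_mul_sq_eq {p q r a b c : ℤ} (hr : r ≠ 0)
    (hpr : IsCoprime p r) (hbc : IsCoprime b c) (h : p * a ^ 2 + q * b ^ 2 = r * c ^ 2) :
    IsCoprime p b := by
  refine isCoprime_of_prime_dvd (fun hc => ?_) fun l hl hlp hlb => ?_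
  · have : r * c ^ 2 = 0 := by rw [← h, hc.1, hc.2]; ring
    rcases mul_eq_zero.1 this with h | h
    · exact hr h
    · have : c = 0 := by simpa using h
      rw [hc.2, this] at hbc
      exact not_isCoprime_zero_zero hbc
  · have h1 : l ∣ r * c ^ 2 := h ▸ dvd_add (hlp.mul_right _) ((dvd_pow hlb two_ne_zero).mul_left _)
    rcases hl.dvd_or_dvd h1 with h2 | h2
    · exact hl.not_isUnit (hpr.isUnit_of_dvd' hlp h2)
    · exact hl.not_isUnit (hbc.isUnit_of_dvd' hlb (hl.dvd_of_dvd_pow h2))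

/-- The two lines into which the conic `p x² + q y² = r z²` degenerates modulo a prime
`l ∣ p q r` are `±α_l + β_l = 0`; every admissible choice of signs carries a small zero. -/
theorem exists_lines {p q r : ℤ} (hp : 0 < p) (hq : 0 < q) (hr : 0 < r)
    (hpq : IsCoprime p q) (hpr : IsCoprime p r) (hqr : IsCoprime q r) {y : Fin 3 → ℤ}
    (hy : ternaryBilin p q r y y = 0) (h01 : IsCoprime (y 0) (y 1))
    (h02 : IsCoprime (y 0) (y 2)) (h12 : IsCoprime (y 1) (y 2)) :
    ∃ α β : ℤ → (Fin 3 → ℤ) → ℤ,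
      (∀ (l h : ℤ) (v : Fin 3 → ℤ), α l (h • v) = h * α l v ∧ β l (h • v) = h * β l v) ∧
      (∀ l, Prime l → l ∣ p * q * r → ∀ v : Fin 3 → ℤ, ternaryBilin p q r v v = 0 →
        IsCoprime (v 0) (v 1) → IsCoprime (v 0) (v 2) → IsCoprime (v 1) (v 2) → ¬ l ∣ α l v) ∧
      ∀ s : ℤ, p * q * r ∣ s ^ 2 - 1 → ∃ v : Fin 3 → ℤ, v ≠ 0 ∧ ternaryBilin p q r v v = 0 ∧
        r * v 2 ^ 2 < 2 * (p * q * r) ∧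
        ∀ l, Prime l → l ∣ p * q * r → l ∣ s * α l v + β l v := by
  have cop {v : Fin 3 → ℤ} (hv : ternaryBilin p q r v v = 0) (h01 : IsCoprime (v 0) (v 1))
      (h02 : IsCoprime (v 0) (v 2)) (h12 : IsCoprime (v 1) (v 2)) :
      IsCoprime p (v 1) ∧ IsCoprime q (v 0) ∧ IsCoprime r (v 0) := by
    simp only [ternaryBilin] at hv
    exact ⟨isCoprime_of_mul_sq_add_mul_sq_eq (q := q) (a := v 0) hr.ne' hpr h12
        (by linear_combination hv),
      isCoprime_of_mul_sq_add_mul_sq_eq (q := p) (a := v 1) hr.ne' hqr h02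
        (by linear_combination hv),
      isCoprime_of_mul_sq_add_mul_sq_eq (q := -p) (a := v 2) hq.ne' hqr.symm h01
        (by linear_combination -hv)⟩
  obtain ⟨c1, c2, c3⟩ := cop hy h01 h02 h12
  classical
  refine ⟨fun l v => if l ∣ p then q * v 1 * y 1 else p * v 0 * y 0,
    fun l v => if l ∣ r then q * v 1 * y 1 else -(r * v 2 * y 2), ?_, ?_, ?_⟩
  · intro l h v
    constructor <;> dsimp only <;> split_ifs <;> simp <;> ring
  · intro l hl hln v hv h01 h02 h12
    obtain ⟨d1, d2, d3⟩ := cop hv h01 h02 h12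
    dsimp only
    split_ifs with h
    · intro hd
      exact hl.not_isUnit (((hpq.mul_right d1).mul_right c1).isUnit_of_dvd' h hd)
    · intro hd
      rcases hl.dvd_or_dvd hln with h' | h'
      · replace h' := (hl.dvd_or_dvd h').resolve_left h
        exact hl.not_isUnit (((hpq.symm.mul_right d2).mul_right c2).isUnit_of_dvd' h' hd)
      · exact hl.not_isUnit (((hpr.symm.mul_right d3).mul_right c3).isUnit_of_dvd' h' hd)
  · intro s hs
    have hcs : IsCoprime (p * q * r) s := by
      obtain ⟨k, hk⟩ := hs
      exact ⟨-k, s, by linear_combination hk⟩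
    obtain ⟨a, b, hab⟩ := hpr
    have hpr : IsCoprime p r := ⟨a, b, hab⟩
    have hsp : IsCoprime p (s * b * r + a * p) := by
      have : IsCoprime p (s + p * (a * (1 - s))) :=
        (hcs.of_isCoprime_of_dvd_left ⟨q * r, by ring⟩).add_mul_left_right _
      convert this using 1
      linear_combination s * hab
    have e1 : s * b * r + a * p = s + p * (a * (1 - s)) := by linear_combination s * hab
    have e2 : s * b * r + a * p = 1 + r * (b * (s - 1)) := by linear_combination hab
    set t := s * b * r + a * p with ht
    obtain ⟨k, hk⟩ := hs
    have hy' : p * y 0 * y 0 + q * y 1 * y 1 - r * y 2 * y 2 = 0 := hy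
    let w : Fin 3 → ℤ := ![s * y 0, t * y 1, y 2]
    have hw : p * q * r ∣ ternaryBilin p q r w w := by
      simp only [ternaryBilin, w, Matrix.cons_val]
      refine (hpr.mul_left hqr).mul_dvd (hpq.mul_dvd ?_ ?_) ?_
      · rw [e1]
        refine ⟨s ^ 2 * y 0 ^ 2 - y 0 ^ 2 + q * r * k * (r * y 2 ^ 2 - p * y 0 ^ 2)
          + q * y 1 ^ 2 * (2 * s * (a * (1 - s)) + p * (a * (1 - s)) ^ 2), ?_⟩
        linear_combination (q * y 1 ^ 2) * hk + (1 + p * q * r * k) * hy'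
      · refine ⟨p * r * k * p * y 0 ^ 2 + t ^ 2 * y 1 ^ 2 - y 1 ^ 2, ?_⟩
        linear_combination (p * y 0 ^ 2) * hk + hy'
      · rw [e2]
        refine ⟨p * q * k * p * y 0 ^ 2
          + q * y 1 ^ 2 * (2 * (b * (s - 1)) + r * (b * (s - 1)) ^ 2), ?_⟩
        linear_combination (p * y 0 ^ 2) * hk + hy'
    obtain ⟨v, hv, hv0, hvw, hv2⟩ := exists_small_zero hp hq hr hpq hpr hqr hw
      (hsp.mul_right c1)
      ((hcs.of_isCoprime_of_dvd_left ⟨p * r, by ring⟩).mul_right c2)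
      ((hcs.of_isCoprime_of_dvd_left ⟨p * q, by ring⟩).mul_right c3)
    refine ⟨v, hv, hv0, hv2, fun l hl hln => ?_⟩
    have hlw := hln.trans hvw
    simp only [ternaryBilin, w, Matrix.cons_val] at hlw
    by_cases hlp : l ∣ p
    · have hlr : ¬ l ∣ r := fun h => hl.not_isUnit (hpr.isUnit_of_dvd' hlp h)
      simp only [hlp, hlr, if_true, if_false]
      obtain ⟨c, rfl⟩ := hlp
      obtain ⟨d, hd⟩ := hlw
      rw [e1] at hd
      exact ⟨d - c * v 0 * (s * y 0) - q * v 1 * c * (a * (1 - s)) * y 1, by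
        linear_combination hd⟩
    · by_cases hlr : l ∣ r
      · simp only [hlp, hlr, if_true, if_false]
        obtain ⟨c, rfl⟩ := hlr
        obtain ⟨d, hd⟩ := hlw
        rw [e2] at hd
        exact ⟨d + c * v 2 * y 2 - q * v 1 * c * (b * (s - 1)) * y 1, by
          linear_combination hd⟩
      · simp only [hlp, hlr, if_false]
        have hlq : l ∣ q :=
          (hl.dvd_or_dvd ((hl.dvd_or_dvd hln).resolve_right hlr)).resolve_left hlp
        obtain ⟨c, rfl⟩ := hlq
        obtain ⟨d, hd⟩ := hlw
        exact ⟨d - c * v 1 * (t * y 1), by linear_combination hd⟩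

/-- The pairs of a divisor `g ∣ p q r` and a positive primitive zero of `p x² + q y² - r z²` such
that `g` times the zero is small. -/
def smallZeros (p q r : ℕ) : Finset (ℕ × ℕ × ℕ × ℕ) :=
  {u ∈ Icc 1 (2 * (p * q * r)) ×ˢ Icc 1 (2 * (p * q * r)) ×ˢ Icc 1 (2 * (p * q * r)) ×ˢ
      Icc 1 (2 * (p * q * r)) |
    u.1 ∣ p * q * r ∧ u.2.1.Coprime u.2.2.1 ∧ u.2.1.Coprime u.2.2.2 ∧
      u.2.2.1.Coprime u.2.2.2 ∧ p * u.2.1 ^ 2 + q * u.2.2.1 ^ 2 = r * u.2.2.2 ^ 2 ∧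
      r * (u.1 * u.2.2.2) ^ 2 ≤ 2 * (p * q * r)}

theorem mem_smallZeros_of_zero {p q r g h : ℕ} (hp : 0 < p) (hq : 0 < q) (hr : 0 < r)
    (hpr : p.Coprime r) (hqr : q.Coprime r)
    (h1 : ¬ (q = 1 ∧ r = 1)) (h2 : ¬ (p = 1 ∧ r = 1)) {v : Fin 3 → ℤ}
    (hv : ternaryBilin p q r v v = 0)
    (h01 : IsCoprime (v 0) (v 1)) (h02 : IsCoprime (v 0) (v 2)) (h12 : IsCoprime (v 1) (v 2))
    (hg : g ∣ p * q * r) (hgh : g ∣ h) (hh : h ≠ 0)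
    (hs : (r : ℤ) * (h * v 2) ^ 2 < 2 * (p * q * r)) :
    (g, (v 0).natAbs, (v 1).natAbs, (v 2).natAbs) ∈ smallZeros p q r := by
  have hn : 0 < p * q * r := by positivity
  have hg0 : 0 < g := Nat.pos_of_dvd_of_pos hg hn
  have he : p * (v 0).natAbs ^ 2 + q * (v 1).natAbs ^ 2 = r * (v 2).natAbs ^ 2 := by
    zify
    simp only [ternaryBilin] at hv
    simp only [sq_abs]
    linear_combination hv
  rw [Int.isCoprime_iff_nat_coprime] at h01 h02 h12
  have hs' : r * (h * (v 2).natAbs) ^ 2 ≤ 2 * (p * q * r) := by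
    zify
    rw [mul_pow, sq_abs, ← mul_pow]
    exact hs.le
  have hgle : g ≤ h := Nat.le_of_dvd (Nat.pos_of_ne_zero hh) hgh
  generalize (v 0).natAbs = a at *
  generalize (v 1).natAbs = b at *
  generalize (v 2).natAbs = c at *
  have hs2 : r * (g * c) ^ 2 ≤ 2 * (p * q * r) := le_trans (by gcongr) hs'
  have ha : a ≠ 0 := by
    rintro rfl
    obtain rfl : b = 1 := by simpa using h01
    obtain rfl : c = 1 := by simpa using h02
    have : q = r := by linarith
    subst this
    exact h1 (by simpa using hqr)
  have hb : b ≠ 0 := by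
    rintro rfl
    obtain rfl : a = 1 := by simpa using h01
    obtain rfl : c = 1 := by simpa using h12
    have : p = r := by linarith
    subst this
    exact h2 (by simpa using hpr)
  have hc : c ≠ 0 := by
    rintro rfl
    have : 0 < p * a ^ 2 := by positivity
    nlinarith
  have hcc : c ^ 2 ≤ (g * c) ^ 2 := by gcongr; exact Nat.le_mul_of_pos_left _ hg0
  have hrc : r * c ^ 2 ≤ 2 * (p * q * r) := le_trans (by gcongr) hs2
  have ha2 : a ≤ p * a ^ 2 := (Nat.le_self_pow two_ne_zero a).trans (Nat.le_mul_of_pos_left _ hp)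
  have hb2 : b ≤ q * b ^ 2 := (Nat.le_self_pow two_ne_zero b).trans (Nat.le_mul_of_pos_left _ hq)
  have hc2 : c ≤ r * c ^ 2 := (Nat.le_self_pow two_ne_zero c).trans (Nat.le_mul_of_pos_left _ hr)
  have hgn : g ≤ p * q * r := Nat.le_of_dvd hn hg
  simp only [smallZeros, mem_filter, mem_product, mem_Icc]
  refine ⟨⟨⟨hg0, by omega⟩, ⟨by omega, by omega⟩, ⟨by omega, by omega⟩, by omega, by omega⟩,
    hg, h01, h02, h12, he, hs2⟩

theorem Int.eq_of_natAbs_eq_of_pos_iff {a b : ℤ} (h : a.natAbs = b.natAbs)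
    (hs : 0 < a ↔ 0 < b) : a = b := by
  omega

theorem exists_sign {n : ℕ} (hn : Squarefree n) {E : Finset ℕ} (hE : E ⊆ n.primeFactors) :
    ∃ s : ℤ, (n : ℤ) ∣ s ^ 2 - 1 ∧ (∀ l ∈ E, (l : ℤ) ∣ s + 1) ∧
      ∀ l ∈ n.primeFactors, l ∉ E → (l : ℤ) ∣ s - 1 := by
  have hprod : (∏ l ∈ E, l) * ∏ l ∈ n.primeFactors \ E, l = n := by
    rw [mul_comm, prod_sdiff hE, Nat.prod_primeFactors_of_squarefree hn]
  have hcop : Nat.Coprime (∏ l ∈ E, l) (∏ l ∈ n.primeFactors \ E, l) := by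
    refine Nat.Coprime.prod_left fun l hl => Nat.Coprime.prod_right fun m hm => ?_
    rw [mem_sdiff] at hm
    exact (Nat.coprime_primes (Nat.prime_of_mem_primeFactors (hE hl))
      (Nat.prime_of_mem_primeFactors hm.1)).2 fun h => hm.2 (h ▸ hl)
  obtain ⟨u, v, huv⟩ := Nat.isCoprime_iff_coprime.2 hcop
  have hE (l) (hl : l ∈ E) : (l : ℤ) ∣ (∏ l ∈ E, l : ℕ) :=
    Int.natCast_dvd_natCast.2 (dvd_prod_of_mem _ hl)
  have hE' (l) (hl : l ∈ n.primeFactors \ E) : (l : ℤ) ∣ (∏ l ∈ n.primeFactors \ E, l : ℕ) :=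
    Int.natCast_dvd_natCast.2 (dvd_prod_of_mem _ hl)
  generalize (∏ l ∈ E, l) = e at *
  generalize (∏ l ∈ n.primeFactors \ E, l) = f at *
  refine ⟨u * e - v * f, ⟨-4 * u * v, ?_⟩, fun l hl => ?_, fun l hl hl' => ?_⟩
  · rw [← hprod]
    push_cast
    linear_combination (u * e + v * f + 1) * huv
  · have : u * e - v * f + 1 = (e : ℤ) * (2 * u) := by linear_combination -huv
    exact this ▸ (hE l hl).mul_right _
  · have : u * e - v * f - 1 = (f : ℤ) * (-2 * v) := by linear_combination huv
    exact this ▸ (hE' l (mem_sdiff.2 ⟨hl, hl'⟩)).mul_right _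

theorem card_divisors_le_card_smallZeros {p q r : ℕ} (hp : Squarefree p) (hq : Squarefree q)
    (hr : Squarefree r) (hpq : p.Coprime q) (hpr : p.Coprime r) (hqr : q.Coprime r)
    (h1 : ¬ (q = 1 ∧ r = 1)) (h2 : ¬ (p = 1 ∧ r = 1))
    (hsol : ∃ y : ℤ × ℤ × ℤ, y ≠ (0, 0, 0) ∧
      (p : ℤ) * y.1 ^ 2 + (q : ℤ) * y.2.1 ^ 2 = (r : ℤ) * y.2.2 ^ 2) :
    #(p * q * r).divisors ≤ 16 * #(smallZeros p q r) := by
  have hp0 : 0 < p := hp.ne_zero.bot_lt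
  have hq0 : 0 < q := hq.ne_zero.bot_lt
  have hr0 : 0 < r := hr.ne_zero.bot_lt
  have hp' := Int.squarefree_natCast.2 hp
  have hq' := Int.squarefree_natCast.2 hq
  have hr' := Int.squarefree_natCast.2 hr
  have hn : Squarefree (p * q * r) :=
    Nat.squarefree_mul_iff.2 ⟨hpr.mul_left hqr, Nat.squarefree_mul_iff.2 ⟨hpq, hp, hq⟩, hr⟩
  obtain ⟨y, hy0, hy1, hy2, hy3, hy4⟩ : ∃ y : Fin 3 → ℤ, y ≠ 0 ∧ ternaryBilin p q r y y = 0 ∧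
      IsCoprime (y 0) (y 1) ∧ IsCoprime (y 0) (y 2) ∧ IsCoprime (y 1) (y 2) := by
    obtain ⟨⟨a, b, c⟩, h0, he⟩ := hsol
    have hv : (![a, b, c] : Fin 3 → ℤ) ≠ 0 := by
      contrapose h0
      have e0 := congrFun h0 0
      have e1 := congrFun h0 1
      have e2 := congrFun h0 2
      simp_all
    obtain ⟨h, u, -, hu, hu'⟩ := exists_eq_smul_pairwise_coprime hp' hq' hr' hv (by
      simp only [ternaryBilin, Matrix.cons_val] at he ⊢
      linear_combination he)
    exact ⟨u, fun h0 => hv (by rw [hu, h0, smul_zero]), hu'⟩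
  obtain ⟨α, β, hlin, hprim, hex⟩ := exists_lines (by exact_mod_cast hp0) (by exact_mod_cast hq0)
    (by exact_mod_cast hr0) (Nat.isCoprime_iff_coprime.2 hpq) (Nat.isCoprime_iff_coprime.2 hpr)
    (Nat.isCoprime_iff_coprime.2 hqr) hy1 hy2 hy3 hy4
  classical
  set P := (p * q * r).primeFactors.erase 2 with hP
  let T (v : Fin 3 → ℤ) : Finset ℕ := {l ∈ P | (l : ℤ) ∣ -1 * α l v + β l v}
  have hPp {l : ℕ} (hl : l ∈ P) : Prime (l : ℤ) ∧ (l : ℤ) ∣ p * q * r := by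
    have := Nat.mem_primeFactors.1 (mem_of_mem_erase hl)
    exact ⟨Nat.prime_iff_prime_int.1 this.1, by exact_mod_cast this.2.1⟩
  have hchoice : ∀ E ∈ P.powerset, ∃ (h : ℕ) (v : Fin 3 → ℤ), h ≠ 0 ∧
      ternaryBilin p q r v v = 0 ∧
      IsCoprime (v 0) (v 1) ∧ IsCoprime (v 0) (v 2) ∧ IsCoprime (v 1) (v 2) ∧
      (r : ℤ) * (h * v 2) ^ 2 < 2 * (p * q * r) ∧ ∀ l ∈ symmDiff E (T v), l ∣ h := by
    intro E hE
    rw [mem_powerset] at hE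
    obtain ⟨s, hs, hs1, hs2⟩ := exists_sign hn (hE.trans (erase_subset _ _))
    obtain ⟨w, hw, hw0, hws, hwl⟩ := hex s (by exact_mod_cast hs)
    obtain ⟨h, v, hh, rfl, hv⟩ := exists_eq_smul_pairwise_coprime hp' hq' hr' hw hw0
    refine ⟨h, v, hh, hv.1, hv.2.1, hv.2.2.1, hv.2.2.2, by simpa using hws, fun l hl => ?_⟩
    have key {e : ℤ} (hlP : l ∈ P) (he : (l : ℤ) ∣ s - e) (hT : ¬ (l : ℤ) ∣ e * α l v + β l v) :
        l ∣ h := by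
      obtain ⟨hl1, hl2⟩ := hPp hlP
      have := hwl l hl1 hl2
      rw [(hlin l h v).1, (hlin l h v).2] at this
      have h3 : (l : ℤ) ∣ h * (e * α l v + β l v) := by
        have := dvd_sub this (he.mul_right (h * α l v))
        rwa [show s * (h * α l v) + h * β l v - (s - e) * (h * α l v) =
          h * (e * α l v + β l v) by ring] at this
      exact Int.natCast_dvd_natCast.1 ((hl1.dvd_or_dvd h3).resolve_right hT)
    rcases mem_symmDiff.1 hl with ⟨h1, h2⟩ | ⟨h1, h2⟩
    · exact key (e := -1) (hE h1) (by simpa using hs1 l h1)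
        fun hd => h2 (mem_filter.2 ⟨hE h1, hd⟩)
    · obtain ⟨hlP, hlT⟩ := mem_filter.1 h1
      refine key (e := 1) hlP (hs2 l (mem_of_mem_erase hlP) h2) fun hd => ?_
      obtain ⟨hl1, hl2⟩ := hPp hlP
      have : (l : ℤ) ∣ 2 * α l v := by
        have := dvd_sub hd hlT
        rwa [show 1 * α l v + β l v - (-1 * α l v + β l v) = 2 * α l v by ring] at this
      rcases hl1.dvd_or_dvd this with h3 | h3
      · have h4 : l ∣ 2 := by exact_mod_cast h3
        exact ne_of_mem_erase hlP
          ((Nat.prime_dvd_prime_iff_eq (Nat.prime_iff_prime_int.2 hl1) Nat.prime_two).1 h4)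
      · exact hprim l hl1 hl2 v hv.1 hv.2.1 hv.2.2.1 hv.2.2.2 h3
  choose! h v hh hv h01 h02 h12 hsmall hdvd using hchoice
  have hsub {E : Finset ℕ} (hE : E ∈ P.powerset) :
      symmDiff E (T (v E)) ⊆ (p * q * r).primeFactors := by
    intro l hl
    rcases mem_symmDiff.1 hl with h | h
    · exact mem_of_mem_erase (mem_powerset.1 hE h.1)
    · exact mem_of_mem_erase (mem_filter.1 h.1).1
  have hcard : #P.powerset ≤ #(smallZeros p q r ×ˢ (univ : Finset (Bool × Bool × Bool))) := by
    refine card_le_card_of_injOn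
      (fun E => ((∏ l ∈ symmDiff E (T (v E)), l, (v E 0).natAbs, (v E 1).natAbs, (v E 2).natAbs),
        (decide (0 < v E 0), decide (0 < v E 1), decide (0 < v E 2)))) ?_ ?_
    · intro E hE
      refine mem_product.2 ⟨mem_smallZeros_of_zero hp0 hq0 hr0 hpr hqr h1 h2 (hv E hE)
        (h01 E hE) (h02 E hE) (h12 E hE) ?_ ?_ (hh E hE) (hsmall E hE), mem_univ _⟩
      · rw [← Nat.prod_primeFactors_of_squarefree hn]
        exact prod_dvd_prod_of_subset _ _ _ (hsub hE)
      · exact prod_primes_dvd _ (fun l hl => (Nat.prime_of_mem_primeFactors (hsub hE hl)).prime)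
          (hdvd E hE)
    · intro E hE F hF hEF
      simp only [Prod.mk.injEq, decide_eq_decide] at hEF
      obtain ⟨⟨hg, a0, a1, a2⟩, s0, s1, s2⟩ := hEF
      have hvEF : v E = v F := by
        funext i
        fin_cases i
        · exact Int.eq_of_natAbs_eq_of_pos_iff a0 s0
        · exact Int.eq_of_natAbs_eq_of_pos_iff a1 s1
        · exact Int.eq_of_natAbs_eq_of_pos_iff a2 s2
      have hG := congrArg Nat.primeFactors hg
      rw [Nat.primeFactors_prod fun l hl => Nat.prime_of_mem_primeFactors (hsub hE hl),
        Nat.primeFactors_prod fun l hl => Nat.prime_of_mem_primeFactors (hsub hF hl), hvEF] at hG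
      exact symmDiff_left_injective _ hG
  have hd : #(p * q * r).divisors = 2 ^ #(p * q * r).primeFactors := by
    rw [Nat.card_divisors hn.ne_zero, ← prod_const]
    refine prod_congr rfl fun l hl => ?_
    rw [Nat.factorization_eq_one_of_squarefree hn (Nat.prime_of_mem_primeFactors hl)
      (Nat.dvd_of_mem_primeFactors hl)]
  rw [card_product, card_powerset, show #(univ : Finset (Bool × Bool × Bool)) = 8 from rfl] at hcard
  have hPc : #(p * q * r).primeFactors ≤ #P + 1 := by
    rw [hP]
    exact Nat.sub_le_iff_le_add.1 pred_card_le_card_erase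
  calc #(p * q * r).divisors = 2 ^ #(p * q * r).primeFactors := hd
    _ ≤ 2 ^ (#P + 1) := Nat.pow_le_pow_right two_pos hPc
    _ = 2 * 2 ^ #P := by ring
    _ ≤ 2 * (#(smallZeros p q r) * 8) := by gcongr
    _ = 16 * #(smallZeros p q r) := by ring

theorem card_mul_le_of_dvd_sub {S : Finset (ℕ × ℕ)} {P Q A : ℕ} (hA : 0 < A)
    (hP : ∀ z ∈ S, P ≤ z.1 ∧ z.1 < 2 * P) (hQ : ∀ z ∈ S, Q ≤ z.2 ∧ z.2 < 2 * Q)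
    (hcop : ∀ z ∈ S, z.1.Coprime z.2)
    (hdvd : ∀ z ∈ S, ∀ w ∈ S, (A : ℤ) ∣ z.1 * w.2 - w.1 * z.2) (hAle : A ≤ 8 * (P * Q)) :
    #S * A ≤ 16 * (P * Q) := by
  obtain rfl | ⟨w, hw⟩ := S.eq_empty_or_nonempty
  · simp
  set m : ℕ := 4 * (P * Q) / A with hm
  have hcard : #S ≤ #(Icc (-m : ℤ) m) := by
    refine card_le_card_of_injOn (fun z => ((z.1 * w.2 - w.1 * z.2 : ℤ) / A)) ?_ ?_
    · intro z hz
      obtain ⟨e, he⟩ := hdvd z hz w hw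
      have hA' : (0 : ℤ) < A := by exact_mod_cast hA
      have h1 : z.1 * w.2 ≤ 4 * (P * Q) := by
        calc z.1 * w.2 ≤ (2 * P) * (2 * Q) := Nat.mul_le_mul (hP z hz).2.le (hQ w hw).2.le
          _ = _ := by ring
      have h2 : w.1 * z.2 ≤ 4 * (P * Q) := by
        calc w.1 * z.2 ≤ (2 * P) * (2 * Q) := Nat.mul_le_mul (hP w hw).2.le (hQ z hz).2.le
          _ = _ := by ring
      have hb : e.natAbs * A ≤ 4 * (P * Q) := by
        have : e.natAbs * A = ((z.1 : ℤ) * w.2 - w.1 * z.2).natAbs := by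
          rw [he, Int.natAbs_mul, Int.natAbs_natCast, mul_comm]
        rw [this]
        zify at h1 h2 ⊢
        rw [abs_le]
        constructor <;> nlinarith [Int.natCast_nonneg (z.1 * w.2), Int.natCast_nonneg (w.1 * z.2)]
      have hem : e.natAbs ≤ m := (Nat.le_div_iff_mul_le hA).2 hb
      simp only [he, Int.mul_ediv_cancel_left _ hA'.ne', coe_Icc, Set.mem_Icc]
      omega
    · intro z hz z' hz' h
      have h' := (Int.ediv_left_inj (hdvd z hz w hw) (hdvd z' hz' w hw)).1 h
      have hw1 : (w.1 : ℤ) ∣ (z.1 - z'.1) * w.2 := ⟨z.2 - z'.2, by linear_combination h'⟩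
      have hw2 := (Nat.isCoprime_iff_coprime.2 (hcop w hw)).dvd_of_dvd_mul_right hw1
      have hz1 := hP z hz
      have hz2 := hP z' hz'
      have hwP := hP w hw
      have h0 : (z.1 : ℤ) - z'.1 = 0 := Int.eq_zero_of_abs_lt_dvd hw2 (by rw [abs_lt]; omega)
      have h3 : (w.1 : ℤ) * (z.2 - z'.2) = 0 := by linear_combination w.2 * h0 - h'
      have h4 : (z.2 : ℤ) - z'.2 = 0 := by
        refine (mul_eq_zero.1 h3).resolve_left ?_
        omega
      exact Prod.ext (by omega) (by omega)
  have hc2 : #(Icc (-m : ℤ) m) = 2 * m + 1 := by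
    rw [Int.card_Icc]
    omega
  have hmA : m * A ≤ 4 * (P * Q) := Nat.div_mul_le_self _ _
  nlinarith

theorem card_pow_three_mul_le {S : Finset (ℕ × ℕ × ℕ)} {P Q R A B C : ℕ}
    (hA : 0 < A) (hB : 0 < B) (hC : 0 < C)
    (hAB : A.Coprime B) (hAC : A.Coprime C)
    (hP : ∀ z ∈ S, P ≤ z.1 ∧ z.1 < 2 * P) (hQ : ∀ z ∈ S, Q ≤ z.2.1 ∧ z.2.1 < 2 * Q)
    (hR : ∀ z ∈ S, R ≤ z.2.2 ∧ z.2.2 < 2 * R)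
    (hcop : ∀ z ∈ S, z.1.Coprime z.2.1 ∧ z.1.Coprime z.2.2 ∧ z.2.1.Coprime z.2.2)
    (heq : ∀ z ∈ S, z.1 * A + z.2.1 * B = z.2.2 * C)
    (hA8 : A ≤ 8 * (Q * R)) (hB8 : B ≤ 8 * (P * R)) (hC8 : C ≤ 8 * (P * Q)) :
    #S ^ 3 * (A * B * C) ≤ 16 ^ 3 * (P * Q * R) ^ 2 := by
  have e1 : #S * A ≤ 16 * (Q * R) := by
    have hinj : Set.InjOn (fun z : ℕ × ℕ × ℕ => (z.2.1, z.2.2)) S := by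
      rintro ⟨x, y, z⟩ h ⟨x', y', z'⟩ h' he
      simp only [Prod.mk.injEq] at he
      obtain ⟨rfl, rfl⟩ := he
      have := heq _ h
      have := heq _ h'
      simp only [Prod.mk.injEq, and_true] at *
      exact Nat.eq_of_mul_eq_mul_right hA (by omega)
    rw [← card_image_of_injOn hinj]
    refine card_mul_le_of_dvd_sub hA ?_ ?_ ?_ ?_ hA8 <;> simp only [forall_mem_image]
    · exact hQ
    · exact hR
    · exact fun z hz => (hcop z hz).2.2
    · intro z hz w hw
      refine (Nat.isCoprime_iff_coprime.2 hAB).dvd_of_dvd_mul_left ⟨w.1 * z.2.2 - z.1 * w.2.2, ?_⟩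
      have h1 := heq z hz
      have h2 := heq w hw
      zify at h1 h2
      linear_combination w.2.2 * h1 - z.2.2 * h2
  have e2 : #S * B ≤ 16 * (P * R) := by
    have hinj : Set.InjOn (fun z : ℕ × ℕ × ℕ => (z.1, z.2.2)) S := by
      rintro ⟨x, y, z⟩ h ⟨x', y', z'⟩ h' he
      simp only [Prod.mk.injEq] at he
      obtain ⟨rfl, rfl⟩ := he
      have := heq _ h
      have := heq _ h'
      simp only [Prod.mk.injEq, and_true, true_and] at *
      exact Nat.eq_of_mul_eq_mul_right hB (by omega)
    rw [← card_image_of_injOn hinj]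
    refine card_mul_le_of_dvd_sub hB ?_ ?_ ?_ ?_ hB8 <;> simp only [forall_mem_image]
    · exact hP
    · exact hR
    · exact fun z hz => (hcop z hz).2.1
    · intro z hz w hw
      refine (Nat.isCoprime_iff_coprime.2 hAB.symm).dvd_of_dvd_mul_left
        ⟨w.2.1 * z.2.2 - z.2.1 * w.2.2, ?_⟩
      have h1 := heq z hz
      have h2 := heq w hw
      zify at h1 h2
      linear_combination w.2.2 * h1 - z.2.2 * h2
  have e3 : #S * C ≤ 16 * (P * Q) := by
    have hinj : Set.InjOn (fun z : ℕ × ℕ × ℕ => (z.1, z.2.1)) S := by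
      rintro ⟨x, y, z⟩ h ⟨x', y', z'⟩ h' he
      simp only [Prod.mk.injEq] at he
      obtain ⟨rfl, rfl⟩ := he
      have := heq _ h
      have := heq _ h'
      simp only [Prod.mk.injEq, true_and] at *
      exact Nat.eq_of_mul_eq_mul_right hC (by omega)
    rw [← card_image_of_injOn hinj]
    refine card_mul_le_of_dvd_sub hC ?_ ?_ ?_ ?_ hC8 <;> simp only [forall_mem_image]
    · exact hP
    · exact hQ
    · exact fun z hz => (hcop z hz).1
    · intro z hz w hw
      refine (Nat.isCoprime_iff_coprime.2 hAC.symm).dvd_of_dvd_mul_left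
        ⟨z.2.2 * w.2.1 - w.2.2 * z.2.1, ?_⟩
      have h1 := heq z hz
      have h2 := heq w hw
      zify at h1 h2
      linear_combination w.2.1 * h1 - z.2.1 * h2
  calc #S ^ 3 * (A * B * C) = (#S * A) * (#S * B) * (#S * C) := by ring
    _ ≤ (16 * (Q * R)) * (16 * (P * R)) * (16 * (P * Q)) := by gcongr
    _ = _ := by ring

/-- The sixth root. -/
noncomputable def sixthRoot (t : ℝ) : ℝ := t ^ (1 / 6 : ℝ)

theorem sixthRoot_nonneg {t : ℝ} (ht : 0 ≤ t) : 0 ≤ sixthRoot t := Real.rpow_nonneg ht _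

theorem sixthRoot_pos {t : ℝ} (ht : 0 < t) : 0 < sixthRoot t := Real.rpow_pos_of_pos ht _

theorem sixthRoot_pow_six {t : ℝ} (ht : 0 ≤ t) : sixthRoot t ^ 6 = t := by
  rw [sixthRoot, ← Real.rpow_natCast, ← Real.rpow_mul ht]
  norm_num

theorem sixthRoot_le_sixthRoot {s t : ℝ} (hs : 0 ≤ s) (h : s ≤ t) : sixthRoot s ≤ sixthRoot t :=
  Real.rpow_le_rpow hs h (by norm_num)

theorem sum_Icc_inv_sixthRoot_pow_four_le (B : ℕ) :
    ∑ a ∈ Icc 1 B, (sixthRoot a ^ 4)⁻¹ ≤ 3 * sixthRoot B ^ 2 := by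
  induction B with
  | zero => simp; positivity
  | succ B ih =>
    rw [sum_Icc_succ_top (by omega)]
    have hu := sixthRoot_nonneg (Nat.cast_nonneg (α := ℝ) B)
    have hv : 0 < sixthRoot (B + 1 : ℕ) := sixthRoot_pos (by positivity)
    have huv : sixthRoot B ≤ sixthRoot (B + 1 : ℕ) :=
      sixthRoot_le_sixthRoot (by positivity) (by push_cast; linarith)
    have hu6 := sixthRoot_pow_six (Nat.cast_nonneg (α := ℝ) B)
    have hv6 := sixthRoot_pow_six (Nat.cast_nonneg (α := ℝ) (B + 1))
    generalize sixthRoot B = u at *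
    generalize sixthRoot (B + 1 : ℕ) = v at *
    push_cast at hv6
    have h2 : u ^ 2 ≤ v ^ 2 := by gcongr
    have key : (v ^ 4)⁻¹ ≤ 3 * (v ^ 2 - u ^ 2) := by
      rw [inv_le_iff_one_le_mul₀ (by positivity)]
      have : 1 = (v ^ 2 - u ^ 2) * (v ^ 4 + v ^ 2 * u ^ 2 + u ^ 4) := by
        linear_combination hu6 - hv6
      rw [this, mul_comm 3, mul_assoc]
      refine mul_le_mul_of_nonneg_left ?_ (by linarith)
      nlinarith [sq_nonneg u, sq_nonneg v]
    linarith

theorem sum_ite_inv_sixthRoot_pow_four_le {M : ℝ} (hM : 0 ≤ M) (L : ℕ) :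
    ∑ a ∈ Icc 1 L, (if (a : ℝ) ^ 2 ≤ M then (sixthRoot a ^ 4)⁻¹ else 0) ≤ 3 * sixthRoot M := by
  rw [← sum_filter]
  have hB : (⌊√M⌋₊ : ℝ) ^ 2 ≤ M :=
    (pow_le_pow_left₀ (by positivity) (Nat.floor_le (Real.sqrt_nonneg _)) 2).trans_eq
      (Real.sq_sqrt hM)
  calc ∑ a ∈ (Icc 1 L).filter fun a : ℕ => (a : ℝ) ^ 2 ≤ M, (sixthRoot a ^ 4)⁻¹
      ≤ ∑ a ∈ Icc 1 ⌊√M⌋₊, (sixthRoot a ^ 4)⁻¹ := by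
        refine sum_le_sum_of_subset_of_nonneg (fun a ha => ?_) fun a _ _ => ?_
        · simp only [mem_filter, mem_Icc] at ha ⊢
          exact ⟨ha.1.1, Nat.le_floor (Real.le_sqrt_of_sq_le ha.2)⟩
        · have := sixthRoot_nonneg (Nat.cast_nonneg (α := ℝ) a)
          positivity
    _ ≤ 3 * sixthRoot ⌊√M⌋₊ ^ 2 := sum_Icc_inv_sixthRoot_pow_four_le _
    _ = 3 * sixthRoot ((⌊√M⌋₊ : ℝ) ^ 2) := by
        simp only [sixthRoot]
        rw [sq, sq, ← Real.mul_rpow (by positivity) (by positivity)]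
    _ ≤ 3 * sixthRoot M := by
        gcongr
        exact sixthRoot_le_sixthRoot (by positivity) hB

theorem sum_product_product_mul {ι κ μ R : Type*} [CommSemiring R] (s : Finset ι) (t : Finset κ)
    (u : Finset μ) (f : ι → R) (g : κ → R) (h : μ → R) :
    ∑ x ∈ s ×ˢ t ×ˢ u, f x.1 * g x.2.1 * h x.2.2 =
      (∑ x ∈ s, f x) * (∑ x ∈ t, g x) * ∑ x ∈ u, h x := by
  simp only [sum_product, mul_assoc, ← mul_sum, ← sum_mul]

theorem sum_Icc_inv_sq_le_two (N : ℕ) : ∑ g ∈ Icc 1 N, ((g : ℝ) ^ 2)⁻¹ ≤ 2 := by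
  have h := sum_Ioo_inv_sq_le (α := ℝ) 0 (N + 1)
  rw [Nat.cast_zero, zero_add, div_one] at h
  exact h

theorem sum_card_divisors_div_le (N : ℕ) :
    ∑ m ∈ Icc 1 N, (#m.divisors : ℝ) / m ≤ (∑ a ∈ Icc 1 N, (a : ℝ)⁻¹) ^ 2 := by
  have h (m) (hm : m ∈ Icc 1 N) : (#m.divisors : ℝ) / m =
      ∑ x ∈ Icc 1 N ×ˢ Icc 1 N with x.1 * x.2 = m, (x.1 : ℝ)⁻¹ * (x.2 : ℝ)⁻¹ := by
    rw [mem_Icc] at hm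
    have hs : {x ∈ Icc 1 N ×ˢ Icc 1 N | x.1 * x.2 = m} = m.divisorsAntidiagonal := by
      ext ⟨a, b⟩
      simp only [mem_filter, mem_product, mem_Icc, Nat.mem_divisorsAntidiagonal]
      constructor
      · rintro ⟨-, h⟩
        exact ⟨h, by omega⟩
      · rintro ⟨rfl, h⟩
        have h0 := mul_ne_zero_iff.1 h
        have := Nat.le_mul_of_pos_right a h0.2.bot_lt
        have := Nat.le_mul_of_pos_left b h0.1.bot_lt
        have := h0.1.bot_lt
        have := h0.2.bot_lt
        simp at *
        omega
    have hc (x) (hx : x ∈ m.divisorsAntidiagonal) : (x.1 : ℝ)⁻¹ * (x.2 : ℝ)⁻¹ = (m : ℝ)⁻¹ := by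
      rw [← mul_inv, ← Nat.cast_mul, (Nat.mem_divisorsAntidiagonal.1 hx).1]
    rw [hs, sum_congr rfl hc, sum_const, ← Nat.map_div_right_divisors, card_map, nsmul_eq_mul,
      div_eq_mul_inv]
  rw [sum_congr rfl h, sq, sum_mul_sum, ← sum_product']
  exact sum_fiberwise_le_sum_of_sum_fiber_nonneg fun _ _ => sum_nonneg fun _ _ => by positivity

theorem natCast_le_of_pow_three_mul_le {n g a b c V : ℕ} (hg : 0 < g) (ha : 0 < a) (hb : 0 < b)
    (hc : 0 < c) (h : n ^ 3 * (g * (a * b * c) ^ 2) ≤ 16 ^ 3 * V ^ 2) :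
    (n : ℝ) ≤ 16 * sixthRoot V ^ 4 / sixthRoot g ^ 2 *
      ((sixthRoot a ^ 4)⁻¹ * (sixthRoot b ^ 4)⁻¹ * (sixthRoot c ^ 4)⁻¹) := by
  have h' : (n : ℝ) ^ 3 * (g * (a * b * c) ^ 2) ≤ 16 ^ 3 * V ^ 2 := by exact_mod_cast h
  have eg := sixthRoot_pow_six (Nat.cast_nonneg (α := ℝ) g)
  have ea := sixthRoot_pow_six (Nat.cast_nonneg (α := ℝ) a)
  have eb := sixthRoot_pow_six (Nat.cast_nonneg (α := ℝ) b)
  have ec := sixthRoot_pow_six (Nat.cast_nonneg (α := ℝ) c)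
  have eV := sixthRoot_pow_six (Nat.cast_nonneg (α := ℝ) V)
  have pg := sixthRoot_pos (Nat.cast_pos (α := ℝ).2 hg)
  have pa := sixthRoot_pos (Nat.cast_pos (α := ℝ).2 ha)
  have pb := sixthRoot_pos (Nat.cast_pos (α := ℝ).2 hb)
  have pc := sixthRoot_pos (Nat.cast_pos (α := ℝ).2 hc)
  have pV := sixthRoot_nonneg (Nat.cast_nonneg (α := ℝ) V)
  rw [← eg, ← ea, ← eb, ← ec, ← eV] at h'
  generalize sixthRoot g = g' at *
  generalize sixthRoot a = a' at *
  generalize sixthRoot b = b' at *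
  generalize sixthRoot c = c' at *
  generalize sixthRoot V = V' at *
  have key : n * (g' ^ 2 * (a' * b' * c') ^ 4) ≤ 16 * V' ^ 4 := by
    refine le_of_pow_le_pow_left₀ three_ne_zero (by positivity) ?_
    linarith
  rw [← mul_inv, ← mul_inv, ← div_eq_mul_inv, div_div, le_div_iff₀ (by positivity)]
  linarith

theorem smallZeros_gcd_decomposition {p q r g a b c g₁ g₂ g₃ z₁ z₂ z₃ : ℕ} (hpq : p.Coprime q)
    (hpr : p.Coprime r) (hqr : q.Coprime r) (h : (g, a, b, c) ∈ smallZeros p q r)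
    (hp : p = g₁ * z₁) (hq : q = g₂ * z₂) (hr : r = g₃ * z₃)
    (h₁ : g.gcd p = g₁) (h₂ : g.gcd q = g₂) (h₃ : g.gcd r = g₃) :
    g = g₁ * g₂ * g₃ ∧ (g₁ * a ^ 2).Coprime (g₂ * b ^ 2) ∧ (g₁ * a ^ 2).Coprime (g₃ * c ^ 2) ∧
      z₁ * (g₁ * a ^ 2) + z₂ * (g₂ * b ^ 2) = z₃ * (g₃ * c ^ 2) ∧
      g * (g₁ * a ^ 2) ≤ 2 * (z₂ * z₃) ∧ g * (g₂ * b ^ 2) ≤ 2 * (z₁ * z₃) ∧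
      g * (g₃ * c ^ 2) ≤ 2 * (z₁ * z₂) := by
  simp only [smallZeros, mem_filter, mem_product, mem_Icc] at h
  obtain ⟨⟨⟨hg0, hg1⟩, -, -, -⟩, hg, hab, hac, hbc, he, hs⟩ := h
  have hn : 0 < p * q * r := by omega
  have hp0 : p ≠ 0 := by rintro rfl; simp at hn
  have hq0 : q ≠ 0 := by rintro rfl; simp at hn
  have hr0 : r ≠ 0 := by rintro rfl; simp at hn
  have hz1 : 0 < z₁ := Nat.pos_of_ne_zero (by rintro rfl; exact hp0 hp)
  have hz2 : 0 < z₂ := Nat.pos_of_ne_zero (by rintro rfl; exact hq0 hq)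
  have hz3 : 0 < z₃ := Nat.pos_of_ne_zero (by rintro rfl; exact hr0 hr)
  have hgg : g = g₁ * g₂ * g₃ := by
    rw [← h₁, ← h₂, ← h₃, ← Nat.Coprime.gcd_mul _ hpq, ← Nat.Coprime.gcd_mul _ (hpr.mul_left hqr),
      Nat.gcd_eq_left hg]
  have he' : (p : ℤ) * a ^ 2 + q * b ^ 2 = r * c ^ 2 := by exact_mod_cast he
  have hpb : p.Coprime b := Nat.isCoprime_iff_coprime.1 (isCoprime_of_mul_sq_add_mul_sq_eq
    (by exact_mod_cast hr0) (Nat.isCoprime_iff_coprime.2 hpr) (Nat.isCoprime_iff_coprime.2 hbc) he')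
  have hqa : q.Coprime a := Nat.isCoprime_iff_coprime.1 (isCoprime_of_mul_sq_add_mul_sq_eq
    (by exact_mod_cast hr0) (Nat.isCoprime_iff_coprime.2 hqr) (Nat.isCoprime_iff_coprime.2 hac)
    (by rw [← he', add_comm]))
  have hpc : p.Coprime c := Nat.isCoprime_iff_coprime.1 (isCoprime_of_mul_sq_add_mul_sq_eq
    (q := -r) (a := a) (r := -q) (by simpa using hq0) (Nat.isCoprime_iff_coprime.2 hpq).neg_right
    (Nat.isCoprime_iff_coprime.2 hbc.symm) (by linear_combination he'))
  have hra : r.Coprime a := Nat.isCoprime_iff_coprime.1 (isCoprime_of_mul_sq_add_mul_sq_eq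
    (q := -p) (a := c) (r := q) (by simpa using hq0) (Nat.isCoprime_iff_coprime.2 hqr).symm
    (Nat.isCoprime_iff_coprime.2 hab) (by linear_combination -he'))
  have d1 : g₁ ∣ p := ⟨_, hp⟩
  have d2 : g₂ ∣ q := ⟨_, hq⟩
  have d3 : g₃ ∣ r := ⟨_, hr⟩
  have hsa : p * (g * a) ^ 2 ≤ 2 * (p * q * r) := 
    calc p * (g * a) ^ 2 = g ^ 2 * (p * a ^ 2) := by ring
      _ ≤ g ^ 2 * (r * c ^ 2) := Nat.mul_le_mul_left _ (by omega)
      _ = r * (g * c) ^ 2 := by ring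
      _ ≤ _ := hs
  have hsb : q * (g * b) ^ 2 ≤ 2 * (p * q * r) := 
    calc q * (g * b) ^ 2 = g ^ 2 * (q * b ^ 2) := by ring
      _ ≤ g ^ 2 * (r * c ^ 2) := Nat.mul_le_mul_left _ (by omega)
      _ = r * (g * c) ^ 2 := by ring
      _ ≤ _ := hs
  refine ⟨hgg, ?_, ?_, ?_, ?_, ?_, ?_⟩
  · refine .mul_left (.mul_right (hpq.of_dvd d1 d2) ((hpb.of_dvd_left d1).pow_right 2))
      (.mul_right ((hqa.of_dvd_left d2).symm.pow_left 2) (hab.pow 2 2))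
  · refine .mul_left (.mul_right (hpr.of_dvd d1 d3) ((hpc.of_dvd_left d1).pow_right 2))
      (.mul_right ((hra.of_dvd_left d3).symm.pow_left 2) (hac.pow 2 2))
  · rw [hp, hq, hr] at he
    linarith
  · refine Nat.le_of_mul_le_mul_left (c := g * z₁) ?_ (by positivity)
    calc g * z₁ * (g * (g₁ * a ^ 2)) = p * (g * a) ^ 2 := by rw [hp]; ring
      _ ≤ _ := hsa
      _ = _ := by rw [hp, hq, hr, hgg]; ring
  · refine Nat.le_of_mul_le_mul_left (c := g * z₂) ?_ (by positivity)
    calc g * z₂ * (g * (g₂ * b ^ 2)) = q * (g * b) ^ 2 := by rw [hq]; ring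
      _ ≤ _ := hsb
      _ = _ := by rw [hp, hq, hr, hgg]; ring
  · refine Nat.le_of_mul_le_mul_left (c := g * z₃) ?_ (by positivity)
    calc g * z₃ * (g * (g₃ * c ^ 2)) = r * (g * c) ^ 2 := by rw [hr]; ring
      _ ≤ _ := hs
      _ = _ := by rw [hp, hq, hr, hgg]; ring

/-- The triple of the gcds of `g` with the entries of `t`. -/
def gcdTriple (g : ℕ) (t : ℕ × ℕ × ℕ) : ℕ × ℕ × ℕ := (g.gcd t.1, g.gcd t.2.1, g.gcd t.2.2)

/-- The entries of `t`, each divided by its gcd with `g`. -/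
def divGcdTriple (g : ℕ) (t : ℕ × ℕ × ℕ) : ℕ × ℕ × ℕ :=
  (t.1 / g.gcd t.1, t.2.1 / g.gcd t.2.1, t.2.2 / g.gcd t.2.2)

/-- The binary logarithms of a triple. -/
def logTriple (z : ℕ × ℕ × ℕ) : ℕ × ℕ × ℕ := (Nat.log 2 z.1, Nat.log 2 z.2.1, Nat.log 2 z.2.2)

theorem card_fiber_pow_three_mul_le {F : Finset ((_ : ℕ × ℕ × ℕ) × ℕ × ℕ × ℕ × ℕ)}
    {k₁ k₂ k₃ g₁ g₂ g₃ a b c : ℕ}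
    (hcop : ∀ i ∈ F, i.1.1.Coprime i.1.2.1 ∧ i.1.1.Coprime i.1.2.2 ∧ i.1.2.1.Coprime i.1.2.2)
    (hmem : ∀ i ∈ F, i.2 ∈ smallZeros i.1.1 i.1.2.1 i.1.2.2)
    (hk : ∀ i ∈ F, logTriple (divGcdTriple i.2.1 i.1) = (k₁, k₂, k₃))
    (hg : ∀ i ∈ F, gcdTriple i.2.1 i.1 = (g₁, g₂, g₃)) (hy : ∀ i ∈ F, i.2.2 = (a, b, c))
    (hF : F.Nonempty) :
    (0 < g₁ ∧ 0 < g₂ ∧ 0 < g₃) ∧ (0 < a ∧ 0 < b ∧ 0 < c) ∧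
      (g₁ * g₂ * g₃) * (g₁ * a ^ 2) ≤ 8 * (2 ^ k₂ * 2 ^ k₃) ∧
      (g₁ * g₂ * g₃) * (g₂ * b ^ 2) ≤ 8 * (2 ^ k₁ * 2 ^ k₃) ∧
      (g₁ * g₂ * g₃) * (g₃ * c ^ 2) ≤ 8 * (2 ^ k₁ * 2 ^ k₂) ∧
      (∀ i ∈ F, g₁ * g₂ * g₃ * (2 ^ k₁ * 2 ^ k₂ * 2 ^ k₃) ≤ i.1.1 * i.1.2.1 * i.1.2.2) ∧
      #F ^ 3 * ((g₁ * g₂ * g₃) * (a * b * c) ^ 2) ≤ 16 ^ 3 * (2 ^ k₁ * 2 ^ k₂ * 2 ^ k₃) ^ 2 := by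
  have key : ∀ i ∈ F, ∃ z₁ z₂ z₃, divGcdTriple i.2.1 i.1 = (z₁, z₂, z₃) ∧
      i.1 = (g₁ * z₁, g₂ * z₂, g₃ * z₃) ∧ i.2 = (g₁ * g₂ * g₃, a, b, c) ∧
      (0 < g₁ ∧ 0 < g₂ ∧ 0 < g₃) ∧ (0 < a ∧ 0 < b ∧ 0 < c) ∧
      (2 ^ k₁ ≤ z₁ ∧ z₁ < 2 * 2 ^ k₁) ∧ (2 ^ k₂ ≤ z₂ ∧ z₂ < 2 * 2 ^ k₂) ∧
      (2 ^ k₃ ≤ z₃ ∧ z₃ < 2 * 2 ^ k₃) ∧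
      (z₁.Coprime z₂ ∧ z₁.Coprime z₃ ∧ z₂.Coprime z₃) ∧
      (g₁ * a ^ 2).Coprime (g₂ * b ^ 2) ∧ (g₁ * a ^ 2).Coprime (g₃ * c ^ 2) ∧
      z₁ * (g₁ * a ^ 2) + z₂ * (g₂ * b ^ 2) = z₃ * (g₃ * c ^ 2) ∧
      (g₁ * g₂ * g₃) * (g₁ * a ^ 2) ≤ 2 * (z₂ * z₃) ∧
      (g₁ * g₂ * g₃) * (g₂ * b ^ 2) ≤ 2 * (z₁ * z₃) ∧
      (g₁ * g₂ * g₃) * (g₃ * c ^ 2) ≤ 2 * (z₁ * z₂) := by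
    rintro ⟨⟨p, q, r⟩, g, y⟩ hi
    obtain rfl := hy _ hi
    have hm := hmem _ hi
    have hk := hk _ hi
    have hg := hg _ hi
    obtain ⟨hpq, hpr, hqr⟩ := hcop _ hi
    simp only [gcdTriple, logTriple, divGcdTriple, Prod.mk.injEq] at *
    have hm' := hm
    simp only [smallZeros, mem_filter, mem_product, mem_Icc] at hm'
    obtain ⟨⟨⟨g0, g1⟩, ⟨a0, -⟩, ⟨b0, -⟩, c0, -⟩, -⟩ := hm'
    obtain ⟨e1, e2, e3⟩ := hg
    have hg1 : 0 < g₁ := e1 ▸ Nat.gcd_pos_of_pos_left _ g0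
    have hg2 : 0 < g₂ := e2 ▸ Nat.gcd_pos_of_pos_left _ g0
    have hg3 : 0 < g₃ := e3 ▸ Nat.gcd_pos_of_pos_left _ g0
    obtain ⟨z₁, hp⟩ : g₁ ∣ p := e1 ▸ Nat.gcd_dvd_right _ _
    obtain ⟨z₂, hq⟩ : g₂ ∣ q := e2 ▸ Nat.gcd_dvd_right _ _
    obtain ⟨z₃, hr⟩ : g₃ ∣ r := e3 ▸ Nat.gcd_dvd_right _ _
    have hn : 0 < p * q * r := by omega
    have hz1 : z₁ ≠ 0 := by rintro rfl; simp [hp] at hn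
    have hz2 : z₂ ≠ 0 := by rintro rfl; simp [hq] at hn
    have hz3 : z₃ ≠ 0 := by rintro rfl; simp [hr] at hn
    have d1 : p / g.gcd p = z₁ := by rw [e1, hp, Nat.mul_div_cancel_left _ hg1]
    have d2 : q / g.gcd q = z₂ := by rw [e2, hq, Nat.mul_div_cancel_left _ hg2]
    have d3 : r / g.gcd r = z₃ := by rw [e3, hr, Nat.mul_div_cancel_left _ hg3]
    obtain ⟨hgg, hrest⟩ := smallZeros_gcd_decomposition hpq hpr hqr hm hp hq hr e1 e2 e3
    rw [d1, d2, d3] at hk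
    obtain ⟨rfl, rfl, rfl⟩ := hk
    have hlog {z : ℕ} (hz : z ≠ 0) : 2 ^ Nat.log 2 z ≤ z ∧ z < 2 * 2 ^ Nat.log 2 z := by
      refine ⟨Nat.pow_log_le_self 2 hz, ?_⟩
      rw [← Nat.pow_succ']
      exact Nat.lt_pow_succ_log_self one_lt_two z
    have c1 : z₁ ∣ p := ⟨_, hp.trans (mul_comm _ _)⟩
    have c2 : z₂ ∣ q := ⟨_, hq.trans (mul_comm _ _)⟩
    have c3 : z₃ ∣ r := ⟨_, hr.trans (mul_comm _ _)⟩
    refine ⟨z₁, z₂, z₃, ⟨d1, d2, d3⟩, ⟨hp, hq, hr⟩, ⟨hgg, trivial⟩, ⟨hg1, hg2, hg3⟩,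
      ⟨a0, b0, c0⟩, hlog hz1, hlog hz2, hlog hz3,
      ⟨hpq.of_dvd c1 c2, hpr.of_dvd c1 c3, hqr.of_dvd c2 c3⟩, hgg ▸ hrest⟩
  have bound {z w Z W m : ℕ} (h : m ≤ 2 * (z * w)) (hz : z < 2 * Z) (hw : w < 2 * W) :
      m ≤ 8 * (Z * W) :=
    calc m ≤ 2 * (z * w) := h
      _ ≤ 2 * (2 * Z * (2 * W)) := by gcongr
      _ = 8 * (Z * W) := by ring
  obtain ⟨i, hi⟩ := hF
  obtain ⟨z₁, z₂, z₃, -, -, -, ⟨hg1, hg2, hg3⟩, ⟨ha, hb, hc⟩, ⟨-, l1⟩, ⟨-, l2⟩, ⟨-, l3⟩, -, hAB,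
    hAC, -, s1, s2, s3⟩ := key i hi
  have b1 := bound s1 l2 l3
  have b2 := bound s2 l1 l3
  have b3 := bound s3 l1 l2
  have hG : 0 < g₁ * g₂ * g₃ := by positivity
  refine ⟨⟨hg1, hg2, hg3⟩, ⟨ha, hb, hc⟩, b1, b2, b3, fun i hi => ?_, ?_⟩
  · obtain ⟨z₁, z₂, z₃, -, e, -, -, -, ⟨l1, -⟩, ⟨l2, -⟩, ⟨l3, -⟩, -⟩ := key i hi
    rw [e]
    calc g₁ * g₂ * g₃ * (2 ^ k₁ * 2 ^ k₂ * 2 ^ k₃) ≤ g₁ * g₂ * g₃ * (z₁ * z₂ * z₃) := by gcongr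
      _ = _ := by ring
  · have hinj :
        Set.InjOn (fun i : (_ : ℕ × ℕ × ℕ) × ℕ × ℕ × ℕ × ℕ => divGcdTriple i.2.1 i.1) F := by
      rintro ⟨x, u⟩ hi ⟨x', u'⟩ hj hij
      obtain ⟨z₁, z₂, z₃, d, e, f, -⟩ := key _ hi
      obtain ⟨w₁, w₂, w₃, d', e', f', -⟩ := key _ hj
      simp only at *
      rw [d, d'] at hij
      simp only [Prod.mk.injEq] at hij
      obtain ⟨rfl, rfl, rfl⟩ := hij
      rw [e, e', f, f']
    have := card_pow_three_mul_le (S := F.image fun i => divGcdTriple i.2.1 i.1)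
      (P := 2 ^ k₁) (Q := 2 ^ k₂) (R := 2 ^ k₃) (A := g₁ * a ^ 2) (B := g₂ * b ^ 2)
      (C := g₃ * c ^ 2) (by positivity) (by positivity) (by positivity) hAB hAC
      ?_ ?_ ?_ ?_ ?_ ((Nat.le_mul_of_pos_left _ hG).trans b1)
      ((Nat.le_mul_of_pos_left _ hG).trans b2) ((Nat.le_mul_of_pos_left _ hG).trans b3)
    · rw [card_image_of_injOn hinj] at this
      refine le_trans (le_of_eq ?_) this
      ring
    all_goals
      rw [forall_mem_image]
      intro i hi
      obtain ⟨z₁, z₂, z₃, d, -, -, -, -, l1, l2, l3, hz, -, -, he, -⟩ := key i hi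
      rw [d]
      assumption

/-- The weight `t ^ (-2 / 3)` of a number `t` with `t² ≤ M`. -/
noncomputable def cutoffWeight (M : ℝ) (t : ℕ) : ℝ :=
  if (t : ℝ) ^ 2 ≤ M then (sixthRoot t ^ 4)⁻¹ else 0

theorem cutoffWeight_nonneg (M : ℝ) (t : ℕ) : 0 ≤ cutoffWeight M t := by
  have := sixthRoot_nonneg (Nat.cast_nonneg (α := ℝ) t)
  unfold cutoffWeight
  split_ifs <;> positivity

/-- A bound for the contribution of the fibre over the logarithms `k`, the gcds `g` and the
zero `y`. -/
noncomputable def fiberBound (k g y : ℕ × ℕ × ℕ) : ℝ :=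
  16 * sixthRoot (2 ^ k.1 * 2 ^ k.2.1 * 2 ^ k.2.2 : ℕ) ^ 4 /
    sixthRoot (g.1 * g.2.1 * g.2.2 : ℕ) ^ 2 *
    ((g.1 * g.2.1 * g.2.2 * (2 ^ k.1 * 2 ^ k.2.1 * 2 ^ k.2.2) : ℕ) : ℝ)⁻¹ *
    (cutoffWeight (8 * (2 ^ k.2.1 * 2 ^ k.2.2) / (g.1 * g.2.1 * g.2.2 * g.1)) y.1 *
      cutoffWeight (8 * (2 ^ k.1 * 2 ^ k.2.2) / (g.1 * g.2.1 * g.2.2 * g.2.1)) y.2.1 *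
      cutoffWeight (8 * (2 ^ k.1 * 2 ^ k.2.1) / (g.1 * g.2.1 * g.2.2 * g.2.2)) y.2.2)

theorem fiberBound_nonneg (k g y : ℕ × ℕ × ℕ) : 0 ≤ fiberBound k g y := by
  unfold fiberBound
  have h1 := sixthRoot_nonneg (Nat.cast_nonneg (α := ℝ) (2 ^ k.1 * 2 ^ k.2.1 * 2 ^ k.2.2))
  have h2 := cutoffWeight_nonneg
  refine mul_nonneg (by positivity) (mul_nonneg (mul_nonneg (h2 _ _) (h2 _ _)) (h2 _ _))

theorem sum_fiber_inv_le {F : Finset ((_ : ℕ × ℕ × ℕ) × ℕ × ℕ × ℕ × ℕ)} {k g y : ℕ × ℕ × ℕ}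
    (hcop : ∀ i ∈ F, i.1.1.Coprime i.1.2.1 ∧ i.1.1.Coprime i.1.2.2 ∧ i.1.2.1.Coprime i.1.2.2)
    (hmem : ∀ i ∈ F, i.2 ∈ smallZeros i.1.1 i.1.2.1 i.1.2.2)
    (hk : ∀ i ∈ F, logTriple (divGcdTriple i.2.1 i.1) = k)
    (hg : ∀ i ∈ F, gcdTriple i.2.1 i.1 = g) (hy : ∀ i ∈ F, i.2.2 = y) :
    ∑ i ∈ F, ((i.1.1 * i.1.2.1 * i.1.2.2 : ℕ) : ℝ)⁻¹ ≤ fiberBound k g y := by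
  obtain rfl | hF := F.eq_empty_or_nonempty
  · simpa using fiberBound_nonneg k g y
  obtain ⟨k₁, k₂, k₃⟩ := k
  obtain ⟨g₁, g₂, g₃⟩ := g
  obtain ⟨a, b, c⟩ := y
  obtain ⟨⟨hg1, hg2, hg3⟩, ⟨ha, hb, hc⟩, s1, s2, s3, hlow, hcard⟩ :=
    card_fiber_pow_three_mul_le hcop hmem hk hg hy hF
  have hcut {G h w m : ℕ} (hG : 0 < G) (hh : 0 < h) (hs : G * (h * w ^ 2) ≤ 8 * m) :
      (w : ℝ) ^ 2 ≤ 8 * m / (G * h) := by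
    rw [le_div_iff₀ (by positivity)]
    have : ((G * (h * w ^ 2) : ℕ) : ℝ) ≤ (8 * m : ℕ) := by exact_mod_cast hs
    push_cast at this
    linarith
  have hG : 0 < g₁ * g₂ * g₃ := by positivity
  have c1 := hcut hG hg1 s1
  have c2 := hcut hG hg2 s2
  have c3 := hcut hG hg3 s3
  push_cast at c1 c2 c3
  have hcard' := natCast_le_of_pow_three_mul_le hG ha hb hc hcard
  have hV : 0 < g₁ * g₂ * g₃ * (2 ^ k₁ * 2 ^ k₂ * 2 ^ k₃) := by positivity
  calc ∑ i ∈ F, ((i.1.1 * i.1.2.1 * i.1.2.2 : ℕ) : ℝ)⁻¹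
      ≤ ∑ i ∈ F, ((g₁ * g₂ * g₃ * (2 ^ k₁ * 2 ^ k₂ * 2 ^ k₃) : ℕ) : ℝ)⁻¹ := by
        refine sum_le_sum fun i hi => ?_
        have := hlow i hi
        gcongr
    _ = #F * ((g₁ * g₂ * g₃ * (2 ^ k₁ * 2 ^ k₂ * 2 ^ k₃) : ℕ) : ℝ)⁻¹ := by
        rw [sum_const, nsmul_eq_mul]
    _ ≤ _ := mul_le_mul_of_nonneg_right hcard' (by positivity)
    _ = fiberBound (k₁, k₂, k₃) (g₁, g₂, g₃) (a, b, c) := by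
        simp only [fiberBound, cutoffWeight, if_pos c1, if_pos c2, if_pos c3]
        ring

theorem sum_fiberBound_le (L : ℕ) (k : ℕ × ℕ × ℕ) {g : ℕ × ℕ × ℕ} (h1 : 0 < g.1) (h2 : 0 < g.2.1)
    (h3 : 0 < g.2.2) :
    ∑ y ∈ Icc 1 L ×ˢ Icc 1 L ×ˢ Icc 1 L, fiberBound k g y ≤
      1296 * (((g.1 : ℝ) ^ 2)⁻¹ * ((g.2.1 : ℝ) ^ 2)⁻¹ * ((g.2.2 : ℝ) ^ 2)⁻¹) := by
  obtain ⟨k₁, k₂, k₃⟩ := k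
  obtain ⟨g₁, g₂, g₃⟩ := g
  simp only [fiberBound, ← mul_sum] at *
  rw [sum_product_product_mul]
  have hg1 : (0 : ℝ) < g₁ := by exact_mod_cast h1
  have hg2 : (0 : ℝ) < g₂ := by exact_mod_cast h2
  have hg3 : (0 : ℝ) < g₃ := by exact_mod_cast h3
  have hG : 0 < g₁ * g₂ * g₃ := by positivity
  have hV : 0 < 2 ^ k₁ * 2 ^ k₂ * 2 ^ k₃ := by positivity
  set M₁ : ℝ := 8 * (2 ^ k₂ * 2 ^ k₃) / (g₁ * g₂ * g₃ * g₁) with hM1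
  set M₂ : ℝ := 8 * (2 ^ k₁ * 2 ^ k₃) / (g₁ * g₂ * g₃ * g₂) with hM2
  set M₃ : ℝ := 8 * (2 ^ k₁ * 2 ^ k₂) / (g₁ * g₂ * g₃ * g₃) with hM3
  have m1 : 0 < M₁ := by positivity
  have m2 : 0 < M₂ := by positivity
  have m3 : 0 < M₃ := by positivity
  have q1 := sixthRoot_pos m1
  have q2 := sixthRoot_pos m2
  have q3 := sixthRoot_pos m3
  have hprod : (sixthRoot M₁ * sixthRoot M₂ * sixthRoot M₃) *
      sixthRoot (g₁ * g₂ * g₃ : ℕ) ^ 4 ≤ 3 * sixthRoot (2 ^ k₁ * 2 ^ k₂ * 2 ^ k₃ : ℕ) ^ 2 := by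
    have r1 := sixthRoot_nonneg (Nat.cast_nonneg (α := ℝ) (g₁ * g₂ * g₃))
    have r2 := sixthRoot_nonneg (Nat.cast_nonneg (α := ℝ) (2 ^ k₁ * 2 ^ k₂ * 2 ^ k₃))
    refine le_of_pow_le_pow_left₀ (n := 6) (by norm_num) (by positivity) ?_
    have e1 := sixthRoot_pow_six (Nat.cast_nonneg (α := ℝ) (g₁ * g₂ * g₃))
    have e2 := sixthRoot_pow_six (Nat.cast_nonneg (α := ℝ) (2 ^ k₁ * 2 ^ k₂ * 2 ^ k₃))
    calc _ = sixthRoot M₁ ^ 6 * sixthRoot M₂ ^ 6 * sixthRoot M₃ ^ 6 *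
          (sixthRoot (g₁ * g₂ * g₃ : ℕ) ^ 6) ^ 4 := by ring
      _ = 512 * (sixthRoot (2 ^ k₁ * 2 ^ k₂ * 2 ^ k₃ : ℕ) ^ 6) ^ 2 := by
          rw [sixthRoot_pow_six m1.le, sixthRoot_pow_six m2.le, sixthRoot_pow_six m3.le, e1, e2,
            hM1, hM2, hM3]
          push_cast
          field_simp
          ring
      _ ≤ 729 * (sixthRoot (2 ^ k₁ * 2 ^ k₂ * 2 ^ k₃ : ℕ) ^ 6) ^ 2 := by gcongr; norm_num
      _ = _ := by ring
  have hsum : (∑ y ∈ Icc 1 L, cutoffWeight M₁ y) * (∑ y ∈ Icc 1 L, cutoffWeight M₂ y) *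
      (∑ y ∈ Icc 1 L, cutoffWeight M₃ y) ≤
        (3 * sixthRoot M₁) * (3 * sixthRoot M₂) * (3 * sixthRoot M₃) := by
    have hs (M) : 0 ≤ ∑ y ∈ Icc 1 L, cutoffWeight M y := sum_nonneg fun _ _ =>
      cutoffWeight_nonneg _ _
    have := hs M₁
    have := hs M₂
    have := hs M₃
    gcongr
    · exact sum_ite_inv_sixthRoot_pow_four_le m1.le L
    · exact sum_ite_inv_sixthRoot_pow_four_le m2.le L
    · exact sum_ite_inv_sixthRoot_pow_four_le m3.le L
  have r1 := sixthRoot_pos (Nat.cast_pos (α := ℝ).2 hG)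
  have r2 := sixthRoot_pos (Nat.cast_pos (α := ℝ).2 hV)
  refine (mul_le_mul_of_nonneg_left hsum (by positivity)).trans ?_
  have e1 := sixthRoot_pow_six (Nat.cast_nonneg (α := ℝ) (g₁ * g₂ * g₃))
  have e2 := sixthRoot_pow_six (Nat.cast_nonneg (α := ℝ) (2 ^ k₁ * 2 ^ k₂ * 2 ^ k₃))
  have e3 : ((g₁ : ℝ) ^ 2)⁻¹ * ((g₂ : ℝ) ^ 2)⁻¹ * ((g₃ : ℝ) ^ 2)⁻¹ =
      (((g₁ * g₂ * g₃ : ℕ) : ℝ) ^ 2)⁻¹ := by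
    push_cast
    rw [mul_pow, mul_pow, mul_inv, mul_inv]
  rw [e3, Nat.cast_mul (g₁ * g₂ * g₃)]
  generalize sixthRoot (g₁ * g₂ * g₃ : ℕ) = s at *
  generalize sixthRoot (2 ^ k₁ * 2 ^ k₂ * 2 ^ k₃ : ℕ) = v at *
  rw [← e1, ← e2]
  generalize sixthRoot M₁ = x at *
  generalize sixthRoot M₂ = y at *
  generalize sixthRoot M₃ = z at *
  calc _ = 432 * v ^ 4 / (s ^ 12 * v ^ 6) * (x * y * z * s ^ 4) := by
        field_simp
        ring
    _ ≤ 432 * v ^ 4 / (s ^ 12 * v ^ 6) * (3 * v ^ 2) := by gcongr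
    _ = _ := by
        field_simp
        ring

theorem sum_card_smallZeros_div_le {N : ℕ} {T : Finset (ℕ × ℕ × ℕ)}
    (hT : T ⊆ Icc 1 N ×ˢ Icc 1 N ×ˢ Icc 1 N)
    (hcop : ∀ t ∈ T, t.1.Coprime t.2.1 ∧ t.1.Coprime t.2.2 ∧ t.2.1.Coprime t.2.2) :
    ∑ t ∈ T, (#(smallZeros t.1 t.2.1 t.2.2) : ℝ) / ((t.1 * t.2.1 * t.2.2 : ℕ) : ℝ) ≤
      10368 * ((Nat.log 2 N + 1 : ℕ) : ℝ) ^ 3 := by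
  set L := 2 * (N * N * N)
  set I := T.sigma fun t => smallZeros t.1 t.2.1 t.2.2 with hI
  set K := range (Nat.log 2 N + 1)
  have hIT : ∀ i ∈ I, i.1 ∈ T ∧ i.2 ∈ smallZeros i.1.1 i.1.2.1 i.1.2.2 := fun i hi => mem_sigma.1 hi
  calc ∑ t ∈ T, (#(smallZeros t.1 t.2.1 t.2.2) : ℝ) / ((t.1 * t.2.1 * t.2.2 : ℕ) : ℝ)
      = ∑ i ∈ I, ((i.1.1 * i.1.2.1 * i.1.2.2 : ℕ) : ℝ)⁻¹ := by
        simp only [hI, sum_sigma, sum_const, nsmul_eq_mul, div_eq_mul_inv]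
    _ = ∑ j ∈ (K ×ˢ K ×ˢ K) ×ˢ (Icc 1 N ×ˢ Icc 1 N ×ˢ Icc 1 N) ×ˢ (Icc 1 L ×ˢ Icc 1 L ×ˢ Icc 1 L),
          ∑ i ∈ I with (logTriple (divGcdTriple i.2.1 i.1), gcdTriple i.2.1 i.1, i.2.2) = j,
            ((i.1.1 * i.1.2.1 * i.1.2.2 : ℕ) : ℝ)⁻¹ := by
        refine (sum_fiberwise_of_maps_to (fun i hi => ?_) _).symm
        obtain ⟨ht, hu⟩ := hIT i hi
        obtain ⟨⟨p, q, r⟩, g, a, b, c⟩ := i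
        have ht := hT ht
        simp only [smallZeros, mem_filter, mem_product, mem_Icc, logTriple, divGcdTriple, gcdTriple,
          K, mem_range] at ht hu ⊢
        obtain ⟨⟨p1, p2⟩, ⟨q1, q2⟩, r1, r2⟩ := ht
        obtain ⟨⟨⟨g1, -⟩, ⟨a1, a2⟩, ⟨b1, b2⟩, c1, c2⟩, -⟩ := hu
        have hL : 2 * (p * q * r) ≤ 2 * (N * N * N) := by gcongr
        have hlog {w : ℕ} (hw : w ≤ N) : Nat.log 2 (w / g.gcd w) < Nat.log 2 N + 1 :=
          Nat.lt_succ_of_le (Nat.log_mono_right ((Nat.div_le_self _ _).trans hw))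
        have hgcd {w : ℕ} (h0 : 1 ≤ w) (hw : w ≤ N) : 1 ≤ g.gcd w ∧ g.gcd w ≤ N :=
          ⟨Nat.gcd_pos_of_pos_left _ g1, (Nat.gcd_le_right _ h0).trans hw⟩
        exact ⟨⟨hlog p2, hlog q2, hlog r2⟩, ⟨hgcd p1 p2, hgcd q1 q2, hgcd r1 r2⟩,
          ⟨a1, a2.trans hL⟩, ⟨b1, b2.trans hL⟩, c1, c2.trans hL⟩
    _ ≤ ∑ j ∈ (K ×ˢ K ×ˢ K) ×ˢ (Icc 1 N ×ˢ Icc 1 N ×ˢ Icc 1 N) ×ˢ (Icc 1 L ×ˢ Icc 1 L ×ˢ Icc 1 L),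
          fiberBound j.1 j.2.1 j.2.2 := by
        refine sum_le_sum fun j _ => sum_fiber_inv_le (fun i hi => ?_) (fun i hi => ?_)
          (fun i hi => ?_) (fun i hi => ?_) (fun i hi => ?_)
        · exact hcop _ (hIT i (mem_filter.1 hi).1).1
        · exact (hIT i (mem_filter.1 hi).1).2
        · rw [← (mem_filter.1 hi).2]
        · rw [← (mem_filter.1 hi).2]
        · rw [← (mem_filter.1 hi).2]
    _ ≤ ∑ k ∈ K ×ˢ K ×ˢ K, ∑ g ∈ Icc 1 N ×ˢ Icc 1 N ×ˢ Icc 1 N,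
          1296 * (((g.1 : ℝ) ^ 2)⁻¹ * ((g.2.1 : ℝ) ^ 2)⁻¹ * ((g.2.2 : ℝ) ^ 2)⁻¹) := by
        rw [sum_product]
        refine sum_le_sum fun k _ => ?_
        rw [sum_product]
        refine sum_le_sum fun g hg => ?_
        simp only [mem_product, mem_Icc] at hg
        exact sum_fiberBound_le L k hg.1.1 hg.2.1.1 hg.2.2.1
    _ ≤ ∑ k ∈ K ×ˢ K ×ˢ K, 1296 * (2 * 2 * 2) := by
        refine sum_le_sum fun k _ => ?_
        rw [← mul_sum, sum_product_product_mul (Icc 1 N) (Icc 1 N) (Icc 1 N)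
          (fun g : ℕ => ((g : ℝ) ^ 2)⁻¹) (fun g : ℕ => ((g : ℝ) ^ 2)⁻¹)
          (fun g : ℕ => ((g : ℝ) ^ 2)⁻¹)]
        have h := sum_Icc_inv_sq_le_two N
        have h0 : 0 ≤ ∑ g ∈ Icc 1 N, ((g : ℝ) ^ 2)⁻¹ := sum_nonneg fun _ _ => by positivity
        gcongr
    _ = 10368 * ((Nat.log 2 N + 1 : ℕ) : ℝ) ^ 3 := by
        rw [sum_const, card_product, card_product, card_range, nsmul_eq_mul]
        push_cast
        ring

theorem sum_degenerate_le {X : ℝ} (hX : 2 ≤ X) :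
    ∑ m ∈ Icc 1 ⌊X⌋₊, (#m.divisors : ℝ) / m ≤ 14 * Real.log X ^ 3 := by
  have h2 := Real.log_two_gt_d9
  have hl : Real.log 2 ≤ Real.log X := Real.log_le_log two_pos hX
  have hfl : (1 : ℝ) ≤ ⌊X⌋₊ := by exact_mod_cast (Nat.one_le_floor_iff X).2 (by linarith)
  have hH : ∑ a ∈ Icc 1 ⌊X⌋₊, (a : ℝ)⁻¹ ≤ 1 + Real.log X := by
    have h := harmonic_le_one_add_log ⌊X⌋₊
    rw [harmonic_eq_sum_Icc] at h
    push_cast at h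
    exact h.trans (by gcongr; exact Nat.floor_le (by linarith))
  have h0 : 0 ≤ ∑ a ∈ Icc 1 ⌊X⌋₊, (a : ℝ)⁻¹ := sum_nonneg fun _ _ => by positivity
  set l := Real.log X
  have hl' : 0.69 ≤ l := by linarith
  calc _ ≤ (∑ a ∈ Icc 1 ⌊X⌋₊, (a : ℝ)⁻¹) ^ 2 := sum_card_divisors_div_le _
    _ ≤ (1 + l) ^ 2 := by gcongr
    _ ≤ (3 * l) ^ 2 := by gcongr; linarith
    _ ≤ _ := by nlinarith [sq_nonneg l]

theorem natLog_floor_add_one_le {X : ℝ} (hX : 2 ≤ X) :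
    ((Nat.log 2 ⌊X⌋₊ + 1 : ℕ) : ℝ) ≤ 3 * Real.log X := by
  have h2 := Real.log_two_gt_d9
  have hfl : ⌊X⌋₊ ≠ 0 := (Nat.floor_pos.2 (by linarith)).ne'
  have h : (2 : ℝ) ^ (Nat.log 2 ⌊X⌋₊) ≤ X :=
    le_trans (by exact_mod_cast Nat.pow_log_le_self 2 hfl) (Nat.floor_le (by linarith))
  have h' := Real.log_le_log (by positivity) h
  rw [Real.log_pow] at h'
  have hl : Real.log 2 ≤ Real.log X := Real.log_le_log two_pos hX
  push_cast
  nlinarith [Nat.cast_nonneg (α := ℝ) (Nat.log 2 ⌊X⌋₊)]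

open Classical in
/-- Counting soluble ternary diagonal quadratic forms: there is an absolute constant
`C` such that for all `X ≥ 2`,
`∑ d(x₁x₂x₃)/(x₁x₂x₃) ≤ C (log X)³`, the sum being over triples of pairwise coprime
squarefree positive integers with `x₁x₂x₃ ≤ X` for which `x₁y₁² + x₂y₂² = x₃y₃²` has a
nontrivial integer solution.  (Every such triple has each coordinate in `[1, ⌊X⌋]`.) -/
theorem soluble_ternary_quadratic_divisor_sum_bound :
    ∃ C : ℝ, 0 < C ∧ ∀ X : ℝ, 2 ≤ X →
      (∑ t ∈ (Finset.Icc 1 ⌊X⌋₊ ×ˢ Finset.Icc 1 ⌊X⌋₊ ×ˢ Finset.Icc 1 ⌊X⌋₊).filter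
          (fun t : ℕ × ℕ × ℕ =>
            Squarefree t.1 ∧ Squarefree t.2.1 ∧ Squarefree t.2.2 ∧
            Nat.Coprime t.1 t.2.1 ∧ Nat.Coprime t.1 t.2.2 ∧ Nat.Coprime t.2.1 t.2.2 ∧
            ((t.1 * t.2.1 * t.2.2 : ℕ) : ℝ) ≤ X ∧
            ∃ y : ℤ × ℤ × ℤ, y ≠ (0, 0, 0) ∧
              (t.1 : ℤ) * y.1 ^ 2 + (t.2.1 : ℤ) * y.2.1 ^ 2 = (t.2.2 : ℤ) * y.2.2 ^ 2),
        ((t.1 * t.2.1 * t.2.2).divisors.card : ℝ) / ((t.1 * t.2.1 * t.2.2 : ℕ) : ℝ))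
        ≤ C * Real.log X ^ 3 := by
  refine ⟨16 * (10368 * 27) + 14 + 14, by norm_num, fun X hX => ?_⟩
  set N := ⌊X⌋₊
  set S := (Finset.Icc 1 N ×ˢ Finset.Icc 1 N ×ˢ Finset.Icc 1 N).filter fun t : ℕ × ℕ × ℕ =>
    Squarefree t.1 ∧ Squarefree t.2.1 ∧ Squarefree t.2.2 ∧
    Nat.Coprime t.1 t.2.1 ∧ Nat.Coprime t.1 t.2.2 ∧ Nat.Coprime t.2.1 t.2.2 ∧
    ((t.1 * t.2.1 * t.2.2 : ℕ) : ℝ) ≤ X ∧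
    ∃ y : ℤ × ℤ × ℤ, y ≠ (0, 0, 0) ∧
      (t.1 : ℤ) * y.1 ^ 2 + (t.2.1 : ℤ) * y.2.1 ^ 2 = (t.2.2 : ℤ) * y.2.2 ^ 2 with hS
  set f : ℕ × ℕ × ℕ → ℝ := fun t =>
    (#(t.1 * t.2.1 * t.2.2).divisors : ℝ) / ((t.1 * t.2.1 * t.2.2 : ℕ) : ℝ) with hf
  have hf0 (t) : 0 ≤ f t := by positivity
  have hbox : S ⊆ Icc 1 N ×ˢ Icc 1 N ×ˢ Icc 1 N := filter_subset _ _
  set T := {t ∈ S | ¬ (t.2.1 = 1 ∧ t.2.2 = 1) ∧ ¬ (t.1 = 1 ∧ t.2.2 = 1)} with hTdef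
  set D₁ := {t ∈ S | t.2.1 = 1 ∧ t.2.2 = 1} with hD1
  set D₂ := {t ∈ S | t.1 = 1 ∧ t.2.2 = 1} with hD2
  have hcover : S ⊆ (T ∪ D₁) ∪ D₂ := by
    intro t ht
    simp only [hTdef, hD1, hD2, mem_union, mem_filter]
    tauto
  have hT : ∑ t ∈ T, f t ≤ 16 * (10368 * 27) * Real.log X ^ 3 := by
    have hlog := natLog_floor_add_one_le hX
    calc ∑ t ∈ T, f t
        ≤ ∑ t ∈ T, 16 * ((#(smallZeros t.1 t.2.1 t.2.2) : ℝ) /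
            ((t.1 * t.2.1 * t.2.2 : ℕ) : ℝ)) := by
          refine sum_le_sum fun t ht => ?_
          obtain ⟨hts, h1, h2⟩ := mem_filter.1 ht
          obtain ⟨-, s1, s2, s3, c1, c2, c3, -, hsol⟩ := mem_filter.1 hts
          have h : ((#(t.1 * t.2.1 * t.2.2).divisors : ℕ) : ℝ) ≤
              16 * #(smallZeros t.1 t.2.1 t.2.2) := by
            exact_mod_cast card_divisors_le_card_smallZeros s1 s2 s3 c1 c2 c3 h1 h2 hsol
          rw [← mul_div_assoc]
          exact div_le_div_of_nonneg_right h (Nat.cast_nonneg _)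
      _ ≤ 16 * (10368 * ((Nat.log 2 N + 1 : ℕ) : ℝ) ^ 3) := by
          rw [← mul_sum]
          refine mul_le_mul_of_nonneg_left (sum_card_smallZeros_div_le
            ((filter_subset _ _).trans hbox) fun t ht => ?_) (by norm_num)
          obtain ⟨-, -, -, -, c1, c2, c3, -⟩ := mem_filter.1 (mem_filter.1 ht).1
          exact ⟨c1, c2, c3⟩
      _ ≤ 16 * (10368 * (3 * Real.log X) ^ 3) := by gcongr
      _ = _ := by ring
  have hdeg {D : Finset (ℕ × ℕ × ℕ)} (e : ℕ × ℕ × ℕ → ℕ) (hD : ∀ t ∈ D, e t ∈ Icc 1 N)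
      (he : ∀ t ∈ D, t.1 * t.2.1 * t.2.2 = e t) (hinj : Set.InjOn e D) :
      ∑ t ∈ D, f t ≤ 14 * Real.log X ^ 3 := by
    calc ∑ t ∈ D, f t = ∑ t ∈ D, (#(e t).divisors : ℝ) / (e t : ℕ) :=
          sum_congr rfl fun t ht => by simp only [hf, he t ht]
      _ = ∑ m ∈ D.image e, (#m.divisors : ℝ) / m := by rw [sum_image hinj]
      _ ≤ ∑ m ∈ Icc 1 N, (#m.divisors : ℝ) / m :=
          sum_le_sum_of_subset_of_nonneg (image_subset_iff.2 hD) fun _ _ _ => by positivity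
      _ ≤ _ := sum_degenerate_le hX
  have h1 : ∑ t ∈ D₁, f t ≤ 14 * Real.log X ^ 3 := by
    refine hdeg Prod.fst (fun t ht => (mem_product.1 (hbox (mem_filter.1 ht).1)).1)
      (fun t ht => ?_) ?_
    · rw [(mem_filter.1 ht).2.1, (mem_filter.1 ht).2.2, mul_one, mul_one]
    · intro t ht t' ht' h
      obtain ⟨-, a, b⟩ := mem_filter.1 ht
      obtain ⟨-, a', b'⟩ := mem_filter.1 ht'
      exact Prod.ext h (Prod.ext (a.trans a'.symm) (b.trans b'.symm))
  have h2 : ∑ t ∈ D₂, f t ≤ 14 * Real.log X ^ 3 := by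
    refine hdeg (fun t => t.2.1)
      (fun t ht => (mem_product.1 (mem_product.1 (hbox (mem_filter.1 ht).1)).2).1)
      (fun t ht => ?_) ?_
    · rw [(mem_filter.1 ht).2.1, (mem_filter.1 ht).2.2, one_mul, mul_one]
    · intro t ht t' ht' h
      obtain ⟨-, a, b⟩ := mem_filter.1 ht
      obtain ⟨-, a', b'⟩ := mem_filter.1 ht'
      exact Prod.ext (a.trans a'.symm) (Prod.ext h (b.trans b'.symm))
  have hunion (s t : Finset (ℕ × ℕ × ℕ)) : ∑ x ∈ s ∪ t, f x ≤ ∑ x ∈ s, f x + ∑ x ∈ t, f x := by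
    rw [← sum_union_inter]
    exact le_add_of_nonneg_right (sum_nonneg fun _ _ => hf0 _)
  calc ∑ t ∈ S, f t ≤ ∑ t ∈ (T ∪ D₁) ∪ D₂, f t :=
        sum_le_sum_of_subset_of_nonneg hcover fun _ _ _ => hf0 _
    _ ≤ ∑ t ∈ T, f t + ∑ t ∈ D₁, f t + ∑ t ∈ D₂, f t :=
        (hunion _ _).trans (by gcongr; exact hunion _ _)
    _ ≤ _ := by linarith
end

section
/- There exist positive real numbers c1, c2, c3 such that for all T > c3 one has c1·T^{1/2} < 𝒩(T) < c2·T^{1/2}, where 𝒩(T) is the number of pairs (x, y) of coprime integers with x·y·(x+y) ≠ 0, such that each of |x|, |y| and |x+y| is a perfect square and max(|x|, |y|) ≤ T. -/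
/-- `𝒩(T)`: the number of pairs of coprime integers `(x,y)` with `x·y·(x+y) ≠ 0` such
that `|x|`, `|y|` and `|x+y|` are all perfect squares and `max(|x|,|y|) ≤ T`; these are
exactly the Darmon-integral points of standard height at most `T` on the stacky curve
`𝔛(ℙ¹ : (0,2), (−1,2), (∞,2))`. -/
noncomputable def NIntegral (T : ℝ) : ℕ :=
  Set.ncard {p : ℤ × ℤ | IsCoprime p.1 p.2 ∧ p.1 * p.2 * (p.1 + p.2) ≠ 0 ∧
    IsSquare |p.1| ∧ IsSquare |p.2| ∧ IsSquare |p.1 + p.2| ∧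
    ((max |p.1| |p.2| : ℤ) : ℝ) ≤ T}

/-- The components of the Pythagorean triple attached to `(m, n)`, squared, with both signs. -/
def signedTripleSquare (i : Fin 6) (m n : ℤ) : ℤ :=
  ![(m ^ 2 - n ^ 2) ^ 2, (2 * m * n) ^ 2, (m ^ 2 + n ^ 2) ^ 2,
    -(m ^ 2 - n ^ 2) ^ 2, -(2 * m * n) ^ 2, -(m ^ 2 + n ^ 2) ^ 2] i

/-- The squares in a primitive Pythagorean triple, up to sign, come from a pair `(m, n)` whose
entries are at most the square root of the hypotenuse. -/
lemma exists_signedTripleSquare {p q r : ℤ} {K : ℕ} (h : p ^ 2 + q ^ 2 = r ^ 2)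
    (hc : IsCoprime p q) (hr : r.natAbs ≤ K) :
    ∃ m n : ℤ, m ∈ Finset.Icc (-(K.sqrt : ℤ)) K.sqrt ∧ n ∈ Finset.Icc (-(K.sqrt : ℤ)) K.sqrt ∧
      ∀ x : ℤ, (x = p ^ 2 ∨ x = q ^ 2 ∨ x = r ^ 2 ∨ x = -p ^ 2 ∨ x = -q ^ 2 ∨ x = -r ^ 2) →
        ∃ i : Fin 6, signedTripleSquare i m n = x := by
  have ht : PythagoreanTriple p q r := by
    unfold PythagoreanTriple; linarith
  obtain ⟨m, n, hpq, hz, -, -⟩ := PythagoreanTriple.coprime_classification.1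
    ⟨ht, Int.isCoprime_iff_gcd_eq_one.1 hc⟩
  have hmn : m ^ 2 + n ^ 2 ≤ (K : ℤ) := by
    rcases hz with hz | hz <;> omega
  have key : ∀ t : ℤ, t ^ 2 ≤ (K : ℤ) → t ∈ Finset.Icc (-(K.sqrt : ℤ)) K.sqrt := by
    intro t htK
    have h1 : t.natAbs ≤ K.sqrt := by
      rw [Nat.le_sqrt]
      zify
      rw [← sq, sq_abs]
      exact htK
    rw [Finset.mem_Icc]
    omega
  refine ⟨m, n, key m (by nlinarith [sq_nonneg n]), key n (by nlinarith [sq_nonneg m]), ?_⟩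
  have hr2 : r ^ 2 = (m ^ 2 + n ^ 2) ^ 2 := by
    rcases hz with hz | hz <;> rw [hz]
    ring
  intro x hx
  rcases hpq with ⟨rfl, rfl⟩ | ⟨rfl, rfl⟩
  · rcases hx with rfl | rfl | rfl | rfl | rfl | rfl
    exacts [⟨0, rfl⟩, ⟨1, rfl⟩, ⟨2, hr2.symm⟩, ⟨3, rfl⟩, ⟨4, rfl⟩, ⟨5, by rw [hr2]; rfl⟩]
  · rcases hx with rfl | rfl | rfl | rfl | rfl | rfl
    exacts [⟨1, rfl⟩, ⟨0, rfl⟩, ⟨2, hr2.symm⟩, ⟨4, rfl⟩, ⟨3, rfl⟩, ⟨5, by rw [hr2]; rfl⟩]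

/-- The pairs counted by `NIntegral T`. -/
def integralPoints (T : ℝ) : Set (ℤ × ℤ) :=
  {p : ℤ × ℤ | IsCoprime p.1 p.2 ∧ p.1 * p.2 * (p.1 + p.2) ≠ 0 ∧
    IsSquare |p.1| ∧ IsSquare |p.2| ∧ IsSquare |p.1 + p.2| ∧
    ((max |p.1| |p.2| : ℤ) : ℝ) ≤ T}

/-- A finite set containing all integral points of height at most `T` when `K = ⌊√(2T)⌋`. -/
noncomputable def tripleBox (K : ℕ) : Finset (ℤ × ℤ) :=
  ((Finset.univ : Finset (Fin 6 × Fin 6)) ×ˢ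
    (Finset.Icc (-(K.sqrt : ℤ)) K.sqrt ×ˢ Finset.Icc (-(K.sqrt : ℤ)) K.sqrt)).image
    fun a => (signedTripleSquare a.1.1 a.2.1 a.2.2, signedTripleSquare a.1.2 a.2.1 a.2.2)

lemma card_tripleBox_le {K : ℕ} (hK : 1 ≤ K) : (tripleBox K).card ≤ 324 * K := by
  refine Finset.card_image_le.trans ?_
  have h1 : 1 ≤ K.sqrt := Nat.le_sqrt.2 (by omega)
  have h2 : K.sqrt * K.sqrt ≤ K := Nat.sqrt_le K
  have h3 : ((K.sqrt : ℤ) + 1 - -(K.sqrt : ℤ)).toNat = 2 * K.sqrt + 1 := by omega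
  simp only [Finset.card_product, Finset.card_univ, Fintype.card_prod, Fintype.card_fin,
    Int.card_Icc, h3]
  nlinarith

lemma integralPoints_subset (T : ℝ) : integralPoints T ⊆ tripleBox ⌊√(2 * T)⌋₊ := by
  rintro ⟨x, y⟩ ⟨hc, -, ⟨a, ha⟩, ⟨b, hb⟩, ⟨c, hd⟩, hT⟩
  simp only at hc ha hb hd hT
  have hbound : ∀ r : ℤ, r ^ 2 ≤ 2 * max |x| |y| → r.natAbs ≤ ⌊√(2 * T)⌋₊ := by
    intro r hr
    apply Nat.le_floor
    apply Real.le_sqrt_of_sq_le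
    have h1 : ((r ^ 2 : ℤ) : ℝ) ≤ ((2 * max |x| |y| : ℤ) : ℝ) := by exact_mod_cast hr
    have h2 : ((r.natAbs : ℝ)) ^ 2 = ((r ^ 2 : ℤ) : ℝ) := by
      rw [← Int.natAbs_sq]; norm_cast
    rw [h2]
    push_cast at h1 hT ⊢
    linarith
  have main : ∃ p q r : ℤ, p ^ 2 + q ^ 2 = r ^ 2 ∧ IsCoprime p q ∧ r ^ 2 ≤ 2 * max |x| |y| ∧
      (x = p ^ 2 ∨ x = q ^ 2 ∨ x = r ^ 2 ∨ x = -p ^ 2 ∨ x = -q ^ 2 ∨ x = -r ^ 2) ∧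
      (y = p ^ 2 ∨ y = q ^ 2 ∨ y = r ^ 2 ∨ y = -p ^ 2 ∨ y = -q ^ 2 ∨ y = -r ^ 2) := by
    have hm1 := le_max_left |x| |y|
    have hm2 := le_max_right |x| |y|
    rw [← sq] at ha hb hd
    have hd' : c ^ 2 ≤ 2 * max |x| |y| := by
      rw [← hd]; have := abs_add_le x y; linarith
    have ha' : a ^ 2 ≤ 2 * max |x| |y| := by have := abs_nonneg x; linarith
    have hb' : b ^ 2 ≤ 2 * max |x| |y| := by have := abs_nonneg y; linarith
    have h0 := sq_nonneg a
    have h1 := sq_nonneg b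
    have h2 := sq_nonneg c
    have two : (0 : ℕ) < 2 := two_pos
    have cab : IsCoprime a b := by
      rw [← IsCoprime.pow_iff two two, ← ha, ← hb]
      exact hc.abs_abs
    have ccb : IsCoprime c b := by
      rw [← IsCoprime.pow_iff two two, ← hd, ← hb]
      refine IsCoprime.abs_abs ?_
      simpa using (IsCoprime.add_mul_right_left hc 1)
    have cac : IsCoprime a c := by
      rw [← IsCoprime.pow_iff two two, ← hd, ← ha]
      refine IsCoprime.abs_abs ?_
      simpa [add_comm] using (IsCoprime.add_mul_left_right hc 1)
    rcases eq_or_eq_neg_of_abs_eq ha with hx | hx <;>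
    rcases eq_or_eq_neg_of_abs_eq hb with hy | hy <;>
    rcases eq_or_eq_neg_of_abs_eq hd with hz | hz
    · exact ⟨a, b, c, by linarith, cab, hd', by simp [hx], by simp [hy]⟩
    · exact ⟨a, b, c, by linarith, cab, hd', by simp [hx], by simp [hy]⟩
    · exact ⟨c, b, a, by linarith, ccb, ha', by simp [hx], by simp [hy]⟩
    · exact ⟨a, c, b, by linarith, cac, hb', by simp [hx], by simp [hy]⟩
    · exact ⟨a, c, b, by linarith, cac, hb', by simp [hx], by simp [hy]⟩
    · exact ⟨c, b, a, by linarith, ccb, ha', by simp [hx], by simp [hy]⟩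
    · exact ⟨a, b, c, by linarith, cab, hd', by simp [hx], by simp [hy]⟩
    · exact ⟨a, b, c, by linarith, cab, hd', by simp [hx], by simp [hy]⟩
  obtain ⟨p, q, r, h, hpq, hr, hx, hy⟩ := main
  obtain ⟨m, n, hm, hn, H⟩ := exists_signedTripleSquare h hpq (hbound r hr)
  obtain ⟨i, hi⟩ := H x hx
  obtain ⟨j, hj⟩ := H y hy
  simp only [tripleBox, Finset.mem_coe, Finset.mem_image]
  exact ⟨((i, j), (m, n)), by simp only [Finset.mem_product, Finset.mem_univ, hm, hn, and_self],
    by simp [hi, hj]⟩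

/-- Pairs `(m, n)` in the box `[1, R]²` such that `2m` and `n` are coprime. -/
def coprimeBox (R : ℕ) : Finset (ℕ × ℕ) :=
  (Finset.Ioc 0 R ×ˢ Finset.Ioc 0 R).filter fun a => Nat.Coprime (2 * a.1) a.2

lemma sum_inv_odd_sq_le (R : ℕ) :
    ∑ k ∈ Finset.Ioc 0 R, (1 : ℝ) / (2 * k + 1) ^ 2 ≤
      1 / 4 - 1 / (4 * ((R : ℝ) + 1)) := by
  induction R with
  | zero => norm_num
  | succ R ih =>
    rw [← Finset.insert_Ioc_right_eq_Ioc_add_one (Nat.zero_le R), Finset.sum_insert (by simp)]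
    have h : (1 : ℝ) / (2 * ((R + 1 : ℕ) : ℝ) + 1) ^ 2 ≤
        1 / (4 * (R + 1)) - 1 / (4 * (((R + 1 : ℕ) : ℝ) + 1)) := by
      push_cast
      rw [div_sub_div _ _ (by positivity) (by positivity),
        div_le_div_iff₀ (by positivity) (by positivity)]
      have : (0 : ℝ) ≤ R := R.cast_nonneg
      nlinarith
    linarith

lemma card_coprimeBox_ge (R : ℕ) : (R : ℝ) ^ 2 / 4 ≤ (coprimeBox R).card := by
  set I := Finset.Ioc 0 R with hI
  have hsub : I ×ˢ I ⊆ coprimeBox R ∪ ((I ×ˢ I.filter (2 ∣ ·)) ∪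
      I.biUnion fun k => I.filter (2 * k + 1 ∣ ·) ×ˢ I.filter (2 * k + 1 ∣ ·)) := by
    rintro ⟨m, n⟩ hmn
    obtain ⟨hm, hn⟩ := Finset.mem_product.1 hmn
    by_cases hc : Nat.Coprime (2 * m) n
    · exact Finset.mem_union_left _ (Finset.mem_filter.2 ⟨hmn, hc⟩)
    apply Finset.mem_union_right
    obtain ⟨p, hp, hpm, hpn⟩ := Nat.Prime.not_coprime_iff_dvd.1 hc
    rcases hp.eq_two_or_odd' with rfl | ⟨k, rfl⟩
    · exact Finset.mem_union_left _ (Finset.mem_product.2 ⟨hm, Finset.mem_filter.2 ⟨hn, hpn⟩⟩)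
    · apply Finset.mem_union_right
      have hpm' : 2 * k + 1 ∣ m := by
        refine Nat.Coprime.dvd_of_dvd_mul_left ?_ hpm
        simp
      have hk : k ≠ 0 := by rintro rfl; exact Nat.not_prime_one hp
      simp only [hI, Finset.mem_Ioc] at hm hn
      have := Nat.le_of_dvd hm.1 hpm'
      simp only [Finset.mem_biUnion, Finset.mem_product, Finset.mem_filter, hI, Finset.mem_Ioc]
      exact ⟨k, by omega, ⟨hm, hpm'⟩, ⟨hn, hpn⟩⟩
  have hcard := (Finset.card_le_card hsub).trans ((Finset.card_union_le _ _).trans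
    (Nat.add_le_add_left ((Finset.card_union_le _ _).trans
      (Nat.add_le_add_left Finset.card_biUnion_le _)) _))
  simp only [Finset.card_product, hI, Nat.Ioc_filter_dvd_card_eq_div, Nat.card_Ioc,
    Nat.sub_zero] at hcard
  have hcard' : (R : ℝ) * R ≤ (coprimeBox R).card + (R * ((R / 2 : ℕ) : ℝ) +
      ∑ k ∈ Finset.Ioc 0 R, ((R / (2 * k + 1) : ℕ) : ℝ) * ((R / (2 * k + 1) : ℕ) : ℝ)) := by
    exact_mod_cast hcard
  have h2 : ((R / 2 : ℕ) : ℝ) ≤ R / 2 := by simpa using Nat.cast_div_le (α := ℝ) (m := R) (n := 2)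
  have hs : ∑ k ∈ Finset.Ioc 0 R, ((R / (2 * k + 1) : ℕ) : ℝ) * ((R / (2 * k + 1) : ℕ) : ℝ) ≤
      (R : ℝ) ^ 2 * ∑ k ∈ Finset.Ioc 0 R, (1 : ℝ) / (2 * k + 1) ^ 2 := by
    rw [Finset.mul_sum]
    refine Finset.sum_le_sum fun k _ => ?_
    have h3 : ((R / (2 * k + 1) : ℕ) : ℝ) ≤ R / (2 * k + 1) := by
      simpa using Nat.cast_div_le (α := ℝ) (m := R) (n := 2 * k + 1)
    calc _ ≤ ((R : ℝ) / (2 * k + 1)) * (R / (2 * k + 1)) := by gcongr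
      _ = _ := by field_simp
  have hq : ∑ k ∈ Finset.Ioc 0 R, (1 : ℝ) / (2 * k + 1) ^ 2 ≤ 1 / 4 := by
    have := sum_inv_odd_sq_le R
    have : (0 : ℝ) ≤ 1 / (4 * ((R : ℝ) + 1)) := by positivity
    linarith
  have hR : (0 : ℝ) ≤ R := R.cast_nonneg
  have := mul_le_mul_of_nonneg_left hq (sq_nonneg (R : ℝ))
  have := mul_le_mul_of_nonneg_left h2 hR
  nlinarith

/-- The integral point attached to the Pythagorean triple with parameters `2m` and `n`. -/
def triplePoint (a : ℕ × ℕ) : ℤ × ℤ :=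
  ((2 * (2 * a.1) * a.2) ^ 2, ((2 * a.1) ^ 2 - a.2 ^ 2) ^ 2)

lemma odd_of_mem_coprimeBox {R : ℕ} {a : ℕ × ℕ} (ha : a ∈ coprimeBox R) : a.2 % 2 = 1 := by
  have h := (Finset.mem_filter.1 ha).2
  exact Nat.odd_iff.1 (Nat.coprime_two_left.1 (Nat.Coprime.coprime_mul_right h))

lemma triplePoint_injOn (R : ℕ) : Set.InjOn triplePoint (coprimeBox R) := by
  rintro ⟨m, n⟩ h ⟨m', n'⟩ h' heq
  have hn := odd_of_mem_coprimeBox h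
  have hn' := odd_of_mem_coprimeBox h'
  simp only [triplePoint, Prod.mk.injEq] at heq hn hn' ⊢
  obtain ⟨h1, h2⟩ := heq
  have e1 : (2 * (2 * m) * n : ℤ) = 2 * (2 * m') * n' :=
    (sq_eq_sq₀ (by positivity) (by positivity)).1 h1
  have e2 : ((2 * m) ^ 2 + n ^ 2 : ℤ) = (2 * m') ^ 2 + n' ^ 2 :=
    (sq_eq_sq₀ (by positivity) (by positivity)).1 (by linear_combination h1 + h2)
  have e3 : (2 * m + n : ℤ) = 2 * m' + n' :=
    (sq_eq_sq₀ (by positivity) (by positivity)).1 (by linear_combination e1 + e2)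
  have e4 : (2 * m - n : ℤ) ^ 2 = (2 * m' - n') ^ 2 := by linear_combination e2 - e1
  rcases sq_eq_sq_iff_eq_or_eq_neg.1 e4 with e | e <;> omega

lemma triplePoint_mem {R : ℕ} {T : ℝ} (hT : (5 * (R : ℝ) ^ 2) ^ 2 ≤ T) {a : ℕ × ℕ}
    (ha : a ∈ coprimeBox R) : triplePoint a ∈ integralPoints T := by
  have hodd := odd_of_mem_coprimeBox ha
  obtain ⟨hbox, hcop⟩ := Finset.mem_filter.1 ha
  obtain ⟨m, n⟩ := a
  obtain ⟨hm, hn⟩ := Finset.mem_product.1 hbox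
  simp only [Finset.mem_Ioc] at hm hn hodd hcop
  have hc : IsCoprime (2 * m : ℤ) n := by exact_mod_cast Nat.isCoprime_iff_coprime.2 hcop
  have hsum : ((2 * (2 * m) * n : ℤ)) ^ 2 + ((2 * m) ^ 2 - n ^ 2) ^ 2 =
      ((2 * m) ^ 2 + n ^ 2) ^ 2 := by ring
  have hne : ((2 * m) ^ 2 - n ^ 2 : ℤ) ≠ 0 := by
    intro h
    rcases sq_eq_sq_iff_eq_or_eq_neg.1 (sub_eq_zero.1 h) with e | e <;> omega
  have hm0 : (0 : ℤ) < m := by exact_mod_cast hm.1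
  have hn0 : (0 : ℤ) < n := by exact_mod_cast hn.1
  have hmR : (m : ℤ) ≤ R := by exact_mod_cast hm.2
  have hnR : (n : ℤ) ≤ R := by exact_mod_cast hn.2
  have hw : ((2 * m) ^ 2 + n ^ 2 : ℤ) ≤ 5 * R ^ 2 := by nlinarith
  have hw2 : ((2 * m) ^ 2 + n ^ 2 : ℤ) ^ 2 ≤ (5 * R ^ 2) ^ 2 := by gcongr
  have h2c : IsCoprime (2 : ℤ) ((2 * m) ^ 2 - n ^ 2) := by
    rw [Int.isCoprime_iff_gcd_eq_one, Int.gcd_eq_natAbs]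
    refine Nat.coprime_two_left.2 (Int.natAbs_odd.2 ?_)
    have : Odd (n : ℤ) := by exact_mod_cast Nat.odd_iff.2 hodd
    exact Even.sub_odd (by simp [parity_simps]) this.pow
  have hmc : IsCoprime (2 * m : ℤ) ((2 * m) ^ 2 - n ^ 2) := by
    rw [show ((2 * m) ^ 2 - n ^ 2 : ℤ) = -n ^ 2 + 2 * m * (2 * m) by ring]
    exact IsCoprime.add_mul_left_right hc.pow_right.neg_right _
  have hnc : IsCoprime (n : ℤ) ((2 * m) ^ 2 - n ^ 2) := by
    rw [show ((2 * m) ^ 2 - n ^ 2 : ℤ) = (2 * m) ^ 2 + n * -n by ring]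
    exact IsCoprime.add_mul_left_right hc.symm.pow_right _
  refine ⟨((h2c.mul_left hmc).mul_left hnc).pow, ?_, ?_, ?_, ?_, ?_⟩ <;>
    simp only [triplePoint, hsum, abs_sq]
  · positivity
  · exact IsSquare.sq _
  · exact IsSquare.sq _
  · exact IsSquare.sq _
  · refine le_trans ?_ hT
    have : max ((2 * (2 * m) * n : ℤ) ^ 2) (((2 * m) ^ 2 - n ^ 2) ^ 2) ≤ (5 * R ^ 2) ^ 2 :=
      max_le (by nlinarith [sq_nonneg ((2 * m) ^ 2 - n ^ 2 : ℤ)])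
        (by nlinarith [sq_nonneg (2 * (2 * m) * n : ℤ)])
    exact_mod_cast this

/-- The number of integral points of bounded height on `𝔛(ℙ¹ : (0,2), (−1,2), (∞,2))`
has exact order of magnitude `T^{1/2}`. -/
theorem integral_points_exact_order :
    ∃ c1 c2 c3 : ℝ, 0 < c1 ∧ 0 < c2 ∧ 0 < c3 ∧
      ∀ T : ℝ, c3 < T →
        c1 * T ^ ((1 : ℝ) / 2) < (NIntegral T : ℝ) ∧
        (NIntegral T : ℝ) < c2 * T ^ ((1 : ℝ) / 2) := by
  refine ⟨1 / 80, 1000, 25, by norm_num, by norm_num, by norm_num, fun T hT => ?_⟩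
  rw [← Real.sqrt_eq_rpow]
  have hT0 : 0 ≤ T := by linarith
  have hs : √T ^ 2 = T := Real.sq_sqrt hT0
  have hs5 : 5 < √T := Real.lt_sqrt_of_sq_lt (by linarith)
  have hN : NIntegral T = (integralPoints T).ncard := rfl
  rw [hN]
  constructor
  · set K := ⌊√T / 5⌋₊ with hK
    have hK1 : √T / 5 < K + 1 := Nat.lt_floor_add_one _
    have hK2 : (K : ℝ) ≤ √T / 5 := Nat.floor_le (by positivity)
    have hK3 : 1 ≤ K := Nat.le_floor (by push_cast; linarith)
    set R := K.sqrt with hR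
    have hR1 : 1 ≤ R := Nat.le_sqrt.2 (by omega)
    have hR2 : R * R ≤ K := Nat.sqrt_le K
    have hR3 : K + 1 ≤ (R + 1) * (R + 1) := Nat.succ_le_succ_sqrt K
    have hR4 : K + 1 ≤ 4 * R ^ 2 := by nlinarith
    have hR2' : (R : ℝ) * R ≤ K := by exact_mod_cast hR2
    have hR4' : (K : ℝ) + 1 ≤ 4 * (R : ℝ) ^ 2 := by exact_mod_cast hR4
    have hTR : (5 * (R : ℝ) ^ 2) ^ 2 ≤ T := by
      rw [← hs]
      gcongr
      linarith
    have hcard : (coprimeBox R).card ≤ (integralPoints T).ncard := by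
      rw [← Set.ncard_coe_finset, ← (triplePoint_injOn R).ncard_image]
      refine Set.ncard_le_ncard ?_ ((Finset.finite_toSet _).subset (integralPoints_subset T))
      rintro _ ⟨a, ha, rfl⟩
      exact triplePoint_mem hTR ha
    have hcard' : ((coprimeBox R).card : ℝ) ≤ (integralPoints T).ncard := by exact_mod_cast hcard
    have := card_coprimeBox_ge R
    linarith
  · set K := ⌊√(2 * T)⌋₊ with hK
    have hK1 : 1 ≤ K := Nat.le_floor (Real.le_sqrt_of_sq_le (by push_cast; linarith))
    have hK2 : (K : ℝ) ≤ 2 * √T := by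
      refine (Nat.floor_le (Real.sqrt_nonneg _)).trans (Real.sqrt_le_iff.2 ⟨by positivity, ?_⟩)
      nlinarith
    have hcard : (integralPoints T).ncard ≤ 324 * K := by
      refine le_trans ?_ (card_tripleBox_le hK1)
      rw [← Set.ncard_coe_finset]
      exact Set.ncard_le_ncard (integralPoints_subset T) (Finset.finite_toSet _)
    have hcard' : ((integralPoints T).ncard : ℝ) ≤ 324 * K := by exact_mod_cast hcard
    linarith
end

section
/- Let (a, b) and (x, y) be pairs of coprime integers with a·y − b·x ≠ 0. For each prime p let (t·P)_p be the largest integer m ≥ 0 for which there exists an integer λ coprime to p with x ≡ λ·a (mod p^m) and y ≡ λ·b (mod p^m). Then (t·P)_p = ord_p(a·y − b·x) for every prime p, and consequently ∏_p p^{(t·P)_p} = |a·y − b·x|. -/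
/-- Two coprime integer pairs agree up to a unit multiple modulo `p ^ m` exactly when `p ^ m`
divides their determinant. -/
theorem exists_not_dvd_and_pow_dvd_sub_mul_iff {a b x y : ℤ} (hab : IsCoprime a b)
    (hxy : IsCoprime x y) {p : ℕ} (hp : p.Prime) (m : ℕ) :
    (∃ l : ℤ, ¬ (p : ℤ) ∣ l ∧ (p : ℤ) ^ m ∣ (x - l * a) ∧ (p : ℤ) ^ m ∣ (y - l * b)) ↔
      (p : ℤ) ^ m ∣ a * y - b * x := by
  have hp' : Prime (p : ℤ) := Nat.prime_iff_prime_int.mp hp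
  constructor
  · rintro ⟨l, -, hx, hy⟩
    have h := dvd_sub (hy.mul_left a) (hx.mul_left b)
    rwa [show a * (y - l * b) - b * (x - l * a) = a * y - b * x by ring] at h
  · intro h
    rcases Nat.eq_zero_or_pos m with rfl | hm
    · exact ⟨1, hp'.not_dvd_one, by simp, by simp⟩
    obtain ⟨u, v, huv⟩ := hab
    have hx : (p : ℤ) ^ m ∣ x - (u * x + v * y) * a := by
      rw [show x - (u * x + v * y) * a = -v * (a * y - b * x) by linear_combination -x * huv]
      exact h.mul_left _
    have hy : (p : ℤ) ^ m ∣ y - (u * x + v * y) * b := by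
      rw [show y - (u * x + v * y) * b = u * (a * y - b * x) by linear_combination -y * huv]
      exact h.mul_left _
    refine ⟨u * x + v * y, fun hl => ?_, hx, hy⟩
    have hpm : (p : ℤ) ∣ (p : ℤ) ^ m := dvd_pow_self _ hm.ne'
    exact hp'.not_isUnit (hxy.isUnit_of_dvd'
      ((dvd_iff_dvd_of_dvd_sub (hpm.trans hx)).mpr (hl.mul_right a))
      ((dvd_iff_dvd_of_dvd_sub (hpm.trans hy)).mpr (hl.mul_right b)))

/-- Local intersection multiplicities on `ℙ¹_ℤ`: for coprime integer pairs `(a,b)` and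
`(x,y)` representing `P = [a:b]` and `t = [x:y]` with `a·y − b·x ≠ 0`, and each prime
`p`, the largest `m ≥ 0` for which some `λ` coprime to `p` satisfies
`x ≡ λ·a (mod p^m)` and `y ≡ λ·b (mod p^m)` equals `ord_p(a·y − b·x)`; consequently
the global intersection number `λ(P,t) = ∏_p p^{(t·P)_p}` equals `|a·y − b·x|`. -/
theorem intersection_multiplicity_eq_ord
    (a b x y : ℤ) (hab : IsCoprime a b) (hxy : IsCoprime x y)
    (hne : a * y - b * x ≠ 0) :
    (∀ p : ℕ, p.Prime →
      IsGreatest {m : ℕ | ∃ l : ℤ, ¬ (p : ℤ) ∣ l ∧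
          (p : ℤ) ^ m ∣ (x - l * a) ∧ (p : ℤ) ^ m ∣ (y - l * b)}
        ((a * y - b * x).natAbs.factorization p)) ∧
    (∏ p ∈ (a * y - b * x).natAbs.primeFactors,
        p ^ sSup {m : ℕ | ∃ l : ℤ, ¬ (p : ℤ) ∣ l ∧
          (p : ℤ) ^ m ∣ (x - l * a) ∧ (p : ℤ) ^ m ∣ (y - l * b)}) =
      (a * y - b * x).natAbs := by
  have key : ∀ p : ℕ, p.Prime →
      IsGreatest {m : ℕ | ∃ l : ℤ, ¬ (p : ℤ) ∣ l ∧
          (p : ℤ) ^ m ∣ (x - l * a) ∧ (p : ℤ) ^ m ∣ (y - l * b)}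
        ((a * y - b * x).natAbs.factorization p) := by
    intro p hp
    have hmem (m : ℕ) : (∃ l : ℤ, ¬ (p : ℤ) ∣ l ∧
        (p : ℤ) ^ m ∣ (x - l * a) ∧ (p : ℤ) ^ m ∣ (y - l * b)) ↔
          m ≤ (a * y - b * x).natAbs.factorization p := by
      rw [exists_not_dvd_and_pow_dvd_sub_mul_iff hab hxy hp,
        ← hp.pow_dvd_iff_le_factorization (Int.natAbs_ne_zero.mpr hne),
        ← Int.natCast_dvd, Nat.cast_pow]
    exact ⟨(hmem _).mpr le_rfl, fun m hm => (hmem m).mp hm⟩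
  refine ⟨key, ?_⟩
  rw [Finset.prod_congr rfl fun p hp => by
    rw [(key p (Nat.prime_of_mem_primeFactors hp)).csSup_eq]]
  exact Nat.prod_factorization_pow_eq_self (Int.natAbs_ne_zero.mpr hne)
end
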